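/- arXiv:1904.09782 — 3 statements merged into one kernel-verified Lean document; each statement's English description precedes it below -/
import Mathlib

section
/- Let the coin process X be a Markov chain induced by an irreducible transition matrix W on finite 𝒳 (with H^W(X) > 0), and let the target process Y be a Markov chain whose transition matrix is a direct sum V = ⊕_{ξ=1}^r V_ξ of irreducible matrices on classes 𝒴_ξ with weights w(ξ) = Pr(Y_1 ∈ 𝒴_ξ). Then the infimum average achievable rates satisfy L*_int(X,Y) = L*(X,Y) = (1/H^W(X)) · Σ_{ξ=1}^r w(ξ) H^{V_ξ}(Y). -/
open MeasureTheory Filter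
open scoped ENNReal Classical

noncomputable section

namespace RNG

variable {𝒳 𝒴 : Type*}

/-- The length-`m` prefix of an infinite sequence, as a tuple. -/
def pre (ω : ℕ → 𝒳) (m : ℕ) : Fin m → 𝒳 := fun i => ω i

/-- The length-`m` prefix of an infinite sequence, as a list. -/
def preL (ω : ℕ → 𝒳) (m : ℕ) : List 𝒳 := (List.range m).map ω

/-- `P_{X^m}(x^m)` : the probability of the cylinder set of a finite string `x^m`,
for a process with law `μ`. -/
def cylP [MeasurableSpace 𝒳] (μ : Measure (ℕ → 𝒳)) {m : ℕ} (x : Fin m → 𝒳) : ℝ :=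
  (μ {ω | ∀ i : Fin m, ω i = x i}).toReal

/-- Validity (exact generation) of an algorithm `φ` (given as a full-tree function on finite
coin strings, `none` playing the role of `⊥`): for every target value `y`, the probability
that the algorithm terminates with output `y` equals `PY y`. -/
def Valid {B : Type*} [MeasurableSpace 𝒳] (μ : Measure (ℕ → 𝒳)) (PY : B → ℝ)
    (φ : List 𝒳 → Option B) : Prop :=
  ∀ y : B,
    (μ {ω | ∃ i : ℕ, φ (preL ω i) = some y ∧ ∀ j < i, φ (preL ω j) = none}).toReal = PY y

/-- Strict lexicographic order on strings. -/
def lexLt [LT 𝒳] {m : ℕ} (x' x : Fin m → 𝒳) : Prop :=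
  ∃ i : Fin m, (∀ j : Fin m, j < i → x' j = x j) ∧ x' i < x i

/-- The subinterval of `[0,1)` assigned to the string `x` by the interval algorithm:
strings are arranged in lexicographic order, `x` receiving an interval of length `P x`. -/
def itv [LT 𝒳] [Fintype 𝒳] {m : ℕ} (P : (Fin m → 𝒳) → ℝ) (x : Fin m → 𝒳) : Set ℝ :=
  Set.Ico (∑ x' ∈ Finset.univ.filter (fun x' => lexLt x' x), P x')
    ((∑ x' ∈ Finset.univ.filter (fun x' => lexLt x' x), P x') + P x)

/-- The interval algorithm generating `Y^n` (target law `ν`) from the coin process `μ`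
has stopped after at most `m` coin symbols on the sample `ω`, i.e. the coin interval
`I_{x^m}` is contained in some target interval `J_{y^n}`. -/
def IntStopped [LinearOrder 𝒳] [Fintype 𝒳] [LinearOrder 𝒴] [Fintype 𝒴]
    [MeasurableSpace 𝒳] [MeasurableSpace 𝒴]
    (μ : Measure (ℕ → 𝒳)) (ν : Measure (ℕ → 𝒴)) (n m : ℕ) (ω : ℕ → 𝒳) : Prop :=
  ∃ y : Fin n → 𝒴, itv (fun x : Fin m → 𝒳 => cylP μ x) (pre ω m)
      ⊆ itv (fun y' : Fin n → 𝒴 => cylP ν y') y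

/-- A rate `R` is achievable by the interval algorithm:
`Pr(T_n > nR) → 0` (the stopping time `T_n` is `ℕ`-valued, so `T_n > nR ↔ T_n > ⌊nR⌋`). -/
def IntAchievable [LinearOrder 𝒳] [Fintype 𝒳] [LinearOrder 𝒴] [Fintype 𝒴]
    [MeasurableSpace 𝒳] [MeasurableSpace 𝒴]
    (μ : Measure (ℕ → 𝒳)) (ν : Measure (ℕ → 𝒴)) (R : ℝ) : Prop :=
  0 ≤ R ∧ Tendsto (fun n : ℕ =>
      (μ {ω | ¬ IntStopped μ ν n ⌊(n : ℝ) * R⌋₊ ω}).toReal) atTop (nhds 0)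

/-- `R⋆_int(X,Y)` : the infimum rate achievable by the interval algorithm. -/
def Rint [LinearOrder 𝒳] [Fintype 𝒳] [LinearOrder 𝒴] [Fintype 𝒴]
    [MeasurableSpace 𝒳] [MeasurableSpace 𝒴]
    (μ : Measure (ℕ → 𝒳)) (ν : Measure (ℕ → 𝒴)) : ℝ :=
  sInf {R : ℝ | IntAchievable μ ν R}

/-- A rate `R` is achievable by some sequence of valid algorithms: for each `n` there is a
valid algorithm `φ n` generating `Y^n` and `Pr(T_n > nR) → 0`. -/
def Achievable [MeasurableSpace 𝒳] [MeasurableSpace 𝒴]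
    (μ : Measure (ℕ → 𝒳)) (ν : Measure (ℕ → 𝒴)) (R : ℝ) : Prop :=
  0 ≤ R ∧ ∃ φ : (n : ℕ) → List 𝒳 → Option (Fin n → 𝒴),
    (∀ n : ℕ, Valid μ (fun y : Fin n → 𝒴 => cylP ν y) (φ n)) ∧
    Tendsto (fun n : ℕ =>
      (μ {ω | ∀ i ≤ ⌊(n : ℝ) * R⌋₊, φ n (preL ω i) = none}).toReal) atTop (nhds 0)

/-- `R⋆(X,Y)` : the infimum rate achievable over all valid algorithms. -/
def Rstar [MeasurableSpace 𝒳] [MeasurableSpace 𝒴]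
    (μ : Measure (ℕ → 𝒳)) (ν : Measure (ℕ → 𝒴)) : ℝ :=
  sInf {R : ℝ | Achievable μ ν R}

/-- The expected stopping time `E[T_n]` of the interval algorithm, via `E[T] = ∑_m Pr(T>m)`. -/
def intAvgT [LinearOrder 𝒳] [Fintype 𝒳] [LinearOrder 𝒴] [Fintype 𝒴]
    [MeasurableSpace 𝒳] [MeasurableSpace 𝒴]
    (μ : Measure (ℕ → 𝒳)) (ν : Measure (ℕ → 𝒴)) (n : ℕ) : ℝ≥0∞ :=
  ∑' m : ℕ, μ {ω | ¬ IntStopped μ ν n m ω}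

/-- A rate `L` is average achievable by the interval algorithm: `limsup E[T_n]/n ≤ L`. -/
def IntAvgAchievable [LinearOrder 𝒳] [Fintype 𝒳] [LinearOrder 𝒴] [Fintype 𝒴]
    [MeasurableSpace 𝒳] [MeasurableSpace 𝒴]
    (μ : Measure (ℕ → 𝒳)) (ν : Measure (ℕ → 𝒴)) (L : ℝ≥0∞) : Prop :=
  limsup (fun n : ℕ => intAvgT μ ν n / (n : ℝ≥0∞)) atTop ≤ L

/-- `L⋆_int(X,Y)` : the infimum average achievable rate of the interval algorithm. -/
def Lint [LinearOrder 𝒳] [Fintype 𝒳] [LinearOrder 𝒴] [Fintype 𝒴]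
    [MeasurableSpace 𝒳] [MeasurableSpace 𝒴]
    (μ : Measure (ℕ → 𝒳)) (ν : Measure (ℕ → 𝒴)) : ℝ≥0∞ :=
  sInf {L : ℝ≥0∞ | IntAvgAchievable μ ν L}

/-- A rate `L` is average achievable by some sequence of valid algorithms. -/
def AvgAchievable [MeasurableSpace 𝒳] [MeasurableSpace 𝒴]
    (μ : Measure (ℕ → 𝒳)) (ν : Measure (ℕ → 𝒴)) (L : ℝ≥0∞) : Prop :=
  ∃ φ : (n : ℕ) → List 𝒳 → Option (Fin n → 𝒴),
    (∀ n : ℕ, Valid μ (fun y : Fin n → 𝒴 => cylP ν y) (φ n)) ∧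
    limsup (fun n : ℕ =>
      (∑' m : ℕ, μ {ω | ∀ i ≤ m, φ n (preL ω i) = none}) / (n : ℝ≥0∞)) atTop ≤ L

/-- `L⋆(X,Y)` : the infimum average achievable rate over all valid algorithms. -/
def Lstar [MeasurableSpace 𝒳] [MeasurableSpace 𝒴]
    (μ : Measure (ℕ → 𝒳)) (ν : Measure (ℕ → 𝒴)) : ℝ≥0∞ :=
  sInf {L : ℝ≥0∞ | AvgAchievable μ ν L}

/-- The spectral sup-entropy `H̄(X)`: the event `(1/m) log(1/P_{X^m}(X^m)) ≥ λ` is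
`P_{X^m}(X^m) ≤ 2^{-mλ}`. -/
def specSup [MeasurableSpace 𝒳] (μ : Measure (ℕ → 𝒳)) : ℝ :=
  sInf {lam : ℝ | Tendsto (fun m : ℕ =>
    (μ {ω | cylP μ (pre ω m) ≤ (2 : ℝ) ^ (-((m : ℝ) * lam))}).toReal) atTop (nhds 0)}

/-- The spectral inf-entropy `H̲(X)`: the event `(1/m) log(1/P_{X^m}(X^m)) ≤ λ` is
`P_{X^m}(X^m) ≥ 2^{-mλ}`. -/
def specInf [MeasurableSpace 𝒳] (μ : Measure (ℕ → 𝒳)) : ℝ :=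
  sSup {lam : ℝ | Tendsto (fun m : ℕ =>
    (μ {ω | (2 : ℝ) ^ (-((m : ℝ) * lam)) ≤ cylP μ (pre ω m)}).toReal) atTop (nhds 0)}

/-- The (sup-)entropy rate `H(X) = limsup (1/m) H(X^m)`. -/
def entRate [MeasurableSpace 𝒳] [Fintype 𝒳] (μ : Measure (ℕ → 𝒳)) : ℝ :=
  limsup (fun m : ℕ =>
    (∑ x : Fin m → 𝒳, cylP μ x * Real.logb 2 (1 / cylP μ x)) / (m : ℝ)) atTop

/-- Upper-tail condition: `Pr((1/m) log(1/P_{X^m}(X^m)) ≥ H̄(X)+δ) ≤ K/m²` eventually. -/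
def UpperTail [MeasurableSpace 𝒳] (μ : Measure (ℕ → 𝒳)) : Prop :=
  ∀ δ : ℝ, 0 < δ → ∃ (K : ℝ) (m₀ : ℕ), ∀ m : ℕ, m₀ ≤ m →
    (μ {ω | cylP μ (pre ω m) ≤ (2 : ℝ) ^ (-((m : ℝ) * (specSup μ + δ)))}).toReal
      ≤ K / (m : ℝ) ^ 2

/-- Lower-tail condition: `Pr((1/m) log(1/P_{X^m}(X^m)) ≤ H̲(X)−δ) ≤ K/m²` eventually. -/
def LowerTail [MeasurableSpace 𝒳] (μ : Measure (ℕ → 𝒳)) : Prop :=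
  ∀ δ : ℝ, 0 < δ → ∃ (K : ℝ) (m₀ : ℕ), ∀ m : ℕ, m₀ ≤ m →
    (μ {ω | (2 : ℝ) ^ (-((m : ℝ) * (specInf μ - δ))) ≤ cylP μ (pre ω m)}).toReal
      ≤ K / (m : ℝ) ^ 2

/-- The finite-dimensional distributions of a Markov chain with initial distribution `q`
and transition matrix `W` (`W x x'` is the transition probability from `x` to `x'`). -/
def markovP (q : 𝒳 → ℝ) (W : 𝒳 → 𝒳 → ℝ) : (m : ℕ) → (Fin m → 𝒳) → ℝ
  | 0, _ => 1
  | m + 1, x => q (x 0) * ∏ i : Fin m, W (x i.castSucc) (x i.succ)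

/-- `μ` is the law of the Markov chain with initial distribution `q` and transition matrix `W`. -/
def IsMarkovMeasure [MeasurableSpace 𝒳] (μ : Measure (ℕ → 𝒳)) (q : 𝒳 → ℝ)
    (W : 𝒳 → 𝒳 → ℝ) : Prop :=
  ∀ (m : ℕ) (x : Fin m → 𝒳), cylP μ x = markovP q W m x

/-- `W` is a (row-)stochastic transition matrix. -/
def IsTransMat [Fintype 𝒳] (W : 𝒳 → 𝒳 → ℝ) : Prop :=
  (∀ x x', 0 ≤ W x x') ∧ ∀ x, ∑ x', W x x' = 1

/-- Irreducibility: any state reaches any other in some `k ≥ 1` steps. -/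
def IrreducibleMat [Fintype 𝒳] [DecidableEq 𝒳] (W : Matrix 𝒳 𝒳 ℝ) : Prop :=
  ∀ x x' : 𝒳, ∃ k : ℕ, 1 ≤ k ∧ 0 < (W ^ k) x x'

/-- `π` is a stationary distribution of `W`. -/
def IsStationary [Fintype 𝒳] (π : 𝒳 → ℝ) (W : 𝒳 → 𝒳 → ℝ) : Prop :=
  (∀ x, 0 ≤ π x) ∧ (∑ x, π x = 1) ∧ ∀ x, ∑ x', π x' * W x' x = π x

/-- `q` is a probability distribution (initial distribution). -/
def IsInitial [Fintype 𝒳] (q : 𝒳 → ℝ) : Prop :=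
  (∀ x, 0 ≤ q x) ∧ ∑ x, q x = 1

/-- The entropy rate `H^W(X) = Σ_{x',x} π(x') W(x|x') log (1/W(x|x'))` of a stationary
Markov chain. -/
def matEnt [Fintype 𝒳] (π : 𝒳 → ℝ) (W : 𝒳 → 𝒳 → ℝ) : ℝ :=
  ∑ x' : 𝒳, ∑ x : 𝒳, π x' * W x' x * Real.logb 2 (1 / W x' x)

/-- The weight `w(ξ) = Pr(Y_1 ∈ 𝒴_ξ)` of the irreducible class `ξ` under the initial
distribution `q`, where `c` assigns to each state its class. -/
def wgt [Fintype 𝒴] {r : ℕ} (c : 𝒴 → Fin r) (q : 𝒴 → ℝ) (ξ : Fin r) : ℝ :=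
  ∑ y ∈ Finset.univ.filter (fun y => c y = ξ), q y

/-- The binary entropy function (base 2). -/
def binEnt (t : ℝ) : ℝ := t * Real.logb 2 (1 / t) + (1 - t) * Real.logb 2 (1 / (1 - t))

end RNG

namespace RNG

section Poisson

variable {S : Type*} [Fintype S] [DecidableEq S]

lemma pow_nonneg_of_isTransMat {V : Matrix S S ℝ} (hV : IsTransMat V) (k : ℕ) (x y : S) :
    0 ≤ (V ^ k) x y := by
  induction k generalizing y with
  | zero =>
    rw [pow_zero, Matrix.one_apply]
    split_ifs <;> norm_num
  | succ k ih =>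
    rw [pow_succ, Matrix.mul_apply]
    exact Finset.sum_nonneg fun z _ => mul_nonneg (ih z) (hV.1 z y)

lemma sum_pow_of_isTransMat {V : Matrix S S ℝ} (hV : IsTransMat V) (k : ℕ) (x : S) :
    ∑ y, (V ^ k) x y = 1 := by
  induction k with
  | zero => simp [Matrix.one_apply]
  | succ k ih =>
    simp only [pow_succ, Matrix.mul_apply]
    rw [Finset.sum_comm]
    simp only [← Finset.mul_sum, hV.2, mul_one, ih]

lemma pow_block {r : ℕ} {c : S → Fin r} {V : Matrix S S ℝ}
    (hblock : ∀ y y', c y ≠ c y' → V y y' = 0) (k : ℕ) {x y : S} (hxy : c x ≠ c y) :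
    (V ^ k) x y = 0 := by
  induction k generalizing y with
  | zero =>
    rw [pow_zero, Matrix.one_apply_ne]
    rintro rfl
    exact hxy rfl
  | succ k ih =>
    rw [pow_succ, Matrix.mul_apply]
    refine Finset.sum_eq_zero fun z _ => ?_
    by_cases hz : c x = c z
    · rw [hblock z y (hz ▸ hxy), mul_zero]
    · rw [ih hz, zero_mul]

lemma pow_mulVec_eq_self {V : Matrix S S ℝ} {f : S → ℝ} (hf : V.mulVec f = f) (k : ℕ) :
    (V ^ k).mulVec f = f := by
  induction k with
  | zero => simp
  | succ k ih => rw [pow_succ, ← Matrix.mulVec_mulVec, hf, ih]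

/-- Harmonic functions are constant on irreducible classes. -/
lemma harmonic_const_on_class {r : ℕ} {c : S → Fin r} {V : Matrix S S ℝ} (hV : IsTransMat V)
    (hblock : ∀ y y', c y ≠ c y' → V y y' = 0)
    (hVirr : ∀ (ξ : Fin r) (y y' : S), c y = ξ → c y' = ξ → ∃ k : ℕ, 1 ≤ k ∧ 0 < (V ^ k) y y')
    {f : S → ℝ} (hf : V.mulVec f = f) {x y : S} (hxy : c x = c y) : f x = f y := by
  obtain ⟨z, hz, hmax⟩ := Finset.exists_max_image (Finset.univ.filter fun z => c z = c y) f
    ⟨y, by simp⟩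
  simp only [Finset.mem_filter, Finset.mem_univ, true_and] at hz hmax
  suffices H : ∀ t, c t = c y → f t = f z by rw [H x hxy, H y rfl]
  intro t ht
  obtain ⟨k, -, hk⟩ := hVirr (c y) z t hz ht
  have h0 : ∑ u, (V ^ k) z u * (f z - f u) = 0 := by
    have h1 := congrFun (pow_mulVec_eq_self hf k) z
    simp only [Matrix.mulVec, dotProduct] at h1
    simp only [mul_sub, Finset.sum_sub_distrib, ← Finset.sum_mul, sum_pow_of_isTransMat hV, h1]
    ring
  have hnn : ∀ u ∈ Finset.univ, 0 ≤ (V ^ k) z u * (f z - f u) := by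
    intro u _
    by_cases hu : c u = c y
    · exact mul_nonneg (pow_nonneg_of_isTransMat hV k z u) (sub_nonneg.2 (hmax u hu))
    · rw [pow_block hblock k (fun h => hu (h ▸ hz)), zero_mul]
  have h2 := (Finset.sum_eq_zero_iff_of_nonneg hnn).1 h0 t (Finset.mem_univ _)
  rcases mul_eq_zero.1 h2 with h | h
  · exact absurd h hk.ne'
  · linarith

/-- Solvability of the Poisson equation for a direct sum of irreducible transition matrices. -/
lemma exists_poisson {r : ℕ} {c : S → Fin r} {V : Matrix S S ℝ} (hV : IsTransMat V)
    (hblock : ∀ y y', c y ≠ c y' → V y y' = 0)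
    (hVirr : ∀ (ξ : Fin r) (y y' : S), c y = ξ → c y' = ξ → ∃ k : ℕ, 1 ≤ k ∧ 0 < (V ^ k) y y')
    {π : Fin r → S → ℝ} (hπ : ∀ ξ, IsStationary (π ξ) V)
    (hsupp : ∀ (ξ : Fin r) (y : S), c y ≠ ξ → π ξ y = 0) (h : S → ℝ) :
    ∃ g : S → ℝ, ∀ y, h y + ∑ y', V y y' * g y' = ∑ y', π (c y) y' * h y' + g y := by
  let A : (S → ℝ) →ₗ[ℝ] (S → ℝ) := LinearMap.id - Matrix.mulVecLin V
  let L : (S → ℝ) →ₗ[ℝ] (Fin r → ℝ) := Matrix.mulVecLin (Matrix.of π)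
  have hL : ∀ f ξ, L f ξ = ∑ y, π ξ y * f y := fun f ξ => rfl
  have hA : ∀ f y, A f y = f y - ∑ y', V y y' * f y' := fun f y => rfl
  have hrange : LinearMap.range A ≤ LinearMap.ker L := by
    rintro _ ⟨f, rfl⟩
    rw [LinearMap.mem_ker]
    ext ξ
    simp only [hL, hA, mul_sub, Finset.sum_sub_distrib, Finset.mul_sum, Pi.zero_apply]
    rw [Finset.sum_comm]
    simp only [← mul_assoc, ← Finset.sum_mul, (hπ ξ).2.2, sub_self]
  have hdisj : Disjoint (LinearMap.ker A) (LinearMap.ker L) := by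
    rw [Submodule.disjoint_def]
    intro f hfA hfL
    have hf : V.mulVec f = f := by
      rw [LinearMap.mem_ker] at hfA
      exact (sub_eq_zero.1 hfA).symm
    ext y
    have h1 : L f (c y) = 0 := by rw [LinearMap.mem_ker.1 hfL]; rfl
    have h2 : L f (c y) = ∑ z, π (c y) z * f y := by
      rw [hL]
      refine Finset.sum_congr rfl fun z _ => ?_
      by_cases hz : c z = c y
      · rw [harmonic_const_on_class hV hblock hVirr hf hz]
      · rw [hsupp _ _ hz, zero_mul, zero_mul]
    rw [← Finset.sum_mul, (hπ (c y)).2.1, one_mul] at h2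
    rw [← h2, h1, Pi.zero_apply]
  have heq : LinearMap.range A = LinearMap.ker L := by
    refine Submodule.eq_of_le_of_finrank_le hrange ?_
    have h1 := Submodule.finrank_add_finrank_le_of_disjoint hdisj
    have h2 := LinearMap.finrank_range_add_finrank_ker A
    omega
  let k : S → ℝ := fun y => h y - ∑ y', π (c y) y' * h y'
  have hk : k ∈ LinearMap.ker L := by
    rw [LinearMap.mem_ker]
    ext ξ
    have h1 : ∑ y, π ξ y * ∑ y', π (c y) y' * h y' = ∑ y, π ξ y * ∑ y', π ξ y' * h y' := by
      refine Finset.sum_congr rfl fun y _ => ?_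
      by_cases hy : c y = ξ
      · rw [hy]
      · rw [hsupp _ _ hy, zero_mul, zero_mul]
    simp only [hL, k, mul_sub, Finset.sum_sub_distrib, h1]
    rw [← Finset.sum_mul, (hπ ξ).2.1, one_mul, sub_self, Pi.zero_apply]
  rw [← heq] at hk
  obtain ⟨g, hg⟩ := hk
  refine ⟨g, fun y => ?_⟩
  have h1 := congrFun hg y
  rw [hA] at h1
  simp only [k] at h1
  linarith

end Poisson

end RNG

namespace RNG

section Cylinders

variable {S : Type*} [Fintype S] [MeasurableSpace S] [DiscreteMeasurableSpace S]

omit [Fintype S] [DiscreteMeasurableSpace S] in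
lemma measurable_pre (m : ℕ) : Measurable (fun ω : ℕ → S => pre ω m) :=
  measurable_pi_lambda _ fun i => measurable_pi_apply (i : ℕ)

omit [Fintype S] [MeasurableSpace S] [DiscreteMeasurableSpace S] in
lemma exists_comp_pre {β : Type*} [Nonempty β] {m : ℕ} {f : (ℕ → S) → β}
    (hf : DependsOn f (Set.Iio m)) : ∃ F : (Fin m → S) → β, f = fun ω => F (pre ω m) := by
  have h : Function.FactorsThrough f (fun ω : ℕ → S => pre ω m) := by
    intro ω ω' h
    exact hf fun i hi => congrFun h ⟨i, hi⟩
  obtain ⟨F, hF⟩ := (Function.factorsThrough_iff _).1 h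
  exact ⟨F, hF⟩

lemma measurable_of_dependsOn {β : Type*} [Nonempty β] [MeasurableSpace β] {m : ℕ}
    {f : (ℕ → S) → β} (hf : DependsOn f (Set.Iio m)) : Measurable f := by
  obtain ⟨F, rfl⟩ := exists_comp_pre hf
  exact (Measurable.of_discrete (f := F)).comp (measurable_pre m)

lemma measurableSet_of_dependsOn {m : ℕ} {A : (ℕ → S) → Prop}
    (hA : DependsOn A (Set.Iio m)) : MeasurableSet {ω | A ω} :=
  measurableSet_setOfPred.2 (measurable_of_dependsOn hA)

variable (μ : Measure (ℕ → S)) [IsProbabilityMeasure μ]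

lemma integrable_of_dependsOn {m : ℕ} {f : (ℕ → S) → ℝ} (hf : DependsOn f (Set.Iio m)) :
    Integrable f μ := by
  obtain ⟨F, rfl⟩ := exists_comp_pre hf
  have : IsProbabilityMeasure (μ.map fun ω => pre ω m) :=
    Measure.isProbabilityMeasure_map (measurable_pre m).aemeasurable
  exact (Integrable.of_finite (f := F)).comp_measurable (measurable_pre m)

omit [IsProbabilityMeasure μ] in
lemma cylP_eq_map {m : ℕ} (x : Fin m → S) :
    cylP μ x = (μ.map fun ω => pre ω m).real {x} := by
  rw [Measure.real, Measure.map_apply (measurable_pre m) (measurableSet_singleton x), cylP]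
  congr 2
  ext ω
  simp [pre, funext_iff]

lemma integral_pre {m : ℕ} (F : (Fin m → S) → ℝ) :
    ∫ ω, F (pre ω m) ∂μ = ∑ x, cylP μ x * F x := by
  have : IsProbabilityMeasure (μ.map fun ω => pre ω m) :=
    Measure.isProbabilityMeasure_map (measurable_pre m).aemeasurable
  rw [← integral_map (f := F) (measurable_pre m).aemeasurable
    (Measurable.of_discrete (f := F)).aestronglyMeasurable,
    integral_fintype (Integrable.of_finite (f := F))]
  simp only [cylP_eq_map, smul_eq_mul]

lemma measureReal_pre {m : ℕ} (A : (Fin m → S) → Prop) [DecidablePred A] :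
    μ.real {ω | A (pre ω m)} = ∑ x ∈ Finset.univ.filter A, cylP μ x := by
  have h := integral_pre μ (fun x => if A x then (1 : ℝ) else 0)
  have hm : MeasurableSet {ω : ℕ → S | A (pre ω m)} :=
    (measurable_pre m) (MeasurableSet.of_discrete (s := {x | A x}))
  rw [← integral_indicator_one hm, Finset.sum_filter]
  refine Eq.trans (integral_congr_ae (Eventually.of_forall fun ω => ?_)) (h.trans ?_)
  · by_cases hA : A (pre ω m) <;> simp [Set.indicator, hA]
  · exact Finset.sum_congr rfl fun x _ => by simp

omit [Fintype S] [DiscreteMeasurableSpace S] [IsProbabilityMeasure μ] in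
lemma cylP_nonneg {m : ℕ} (x : Fin m → S) : 0 ≤ cylP μ x := ENNReal.toReal_nonneg

omit [Fintype S] [DiscreteMeasurableSpace S] in
lemma cylP_le_one {m : ℕ} (x : Fin m → S) : cylP μ x ≤ 1 := measureReal_le_one

lemma sum_cylP (m : ℕ) : ∑ x : Fin m → S, cylP μ x = 1 := by
  have h := integral_pre μ (m := m) (fun _ => 1)
  simpa using h.symm

lemma ae_cylP_pos : ∀ᵐ ω ∂μ, ∀ m, 0 < cylP μ (pre ω m) := by
  rw [ae_all_iff]
  intro m
  have h := measureReal_pre μ (m := m) (fun x => ¬ 0 < cylP μ x)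
  rw [Finset.sum_eq_zero] at h
  · exact (measureReal_eq_zero_iff).1 h
  · intro x hx
    exact le_antisymm (not_lt.1 (Finset.mem_filter.1 hx).2) (cylP_nonneg μ x)

omit [Fintype S] [MeasurableSpace S] [DiscreteMeasurableSpace S] in
lemma pre_congr {m : ℕ} {ω ω' : ℕ → S} (h : ∀ i ∈ Set.Iio m, ω i = ω' i) :
    pre ω m = pre ω' m := funext fun i => h i i.2

variable {μ} {p : S → ℝ} {W : S → S → ℝ}

omit [Fintype S] [DiscreteMeasurableSpace S] in
lemma cylP_pre_zero (ω : ℕ → S) : cylP μ (pre ω 0) = 1 := by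
  simp [cylP]

omit [Fintype S] [DiscreteMeasurableSpace S] [IsProbabilityMeasure μ] in
lemma cylP_pre_succ (hμ : IsMarkovMeasure μ p W) (m : ℕ) (ω : ℕ → S) :
    cylP μ (pre ω (m + 2)) = cylP μ (pre ω (m + 1)) * W (ω m) (ω (m + 1)) := by
  rw [hμ, hμ]
  simp only [markovP]
  rw [Fin.prod_univ_castSucc]
  simp [pre, mul_assoc]

omit [Fintype S] [DiscreteMeasurableSpace S] [IsProbabilityMeasure μ] in
lemma cylP_snoc (hμ : IsMarkovMeasure μ p W) {m : ℕ} (x : Fin (m + 1) → S) (a : S) :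
    cylP μ (Fin.snoc x a : Fin (m + 2) → S) = cylP μ x * W (x (Fin.last m)) a := by
  let ω : ℕ → S := fun i => if h : i < m + 1 then x ⟨i, h⟩ else a
  have h1 : (Fin.snoc x a : Fin (m + 2) → S) = pre ω (m + 2) := by
    funext i
    simp only [Fin.snoc, pre, ω, Fin.castLT, cast_eq]
  have h2 : x = pre ω (m + 1) := by
    funext i
    simp only [pre, ω]
    rw [dif_pos i.2]
  rw [h1, cylP_pre_succ hμ, ← h2]
  simp [ω, Fin.last]

lemma integral_markov (hμ : IsMarkovMeasure μ p W) {m : ℕ} {f : (ℕ → S) → ℝ}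
    (hf : DependsOn f (Set.Iio (m + 1))) (u : S → S → ℝ) :
    ∫ ω, f ω * u (ω m) (ω (m + 1)) ∂μ
      = ∫ ω, f ω * ∑ a, W (ω m) a * u (ω m) a ∂μ := by
  obtain ⟨F, rfl⟩ := exists_comp_pre hf
  have h1 := integral_pre μ (m := m + 2) (fun z => F (Fin.init z) *
    u (z (Fin.last m).castSucc) (z (Fin.last (m + 1))))
  have h2 := integral_pre μ (m := m + 1) (fun x => F x *
    ∑ a, W (x (Fin.last m)) a * u (x (Fin.last m)) a)
  refine Eq.trans h1 (Eq.trans ?_ h2.symm)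
  rw [← (Fin.snocEquiv (fun _ : Fin (m + 2) => S)).sum_comp, Fintype.sum_prod_type,
    Finset.sum_comm]
  refine Finset.sum_congr rfl fun x _ => ?_
  simp only [Fin.snocEquiv, Equiv.coe_fn_mk, Fin.init_snoc, Fin.snoc_last, Fin.snoc_castSucc,
    cylP_snoc hμ, Finset.mul_sum]
  exact Finset.sum_congr rfl fun a _ => by ring

end Cylinders

end RNG

namespace RNG

section Entropy

variable {S : Type*} [Fintype S]

/-- The entropy (in nats) of a row of a transition matrix. -/
def rowEnt (W : S → S → ℝ) (x : S) : ℝ := ∑ a, W x a * -Real.log (W x a)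

/-- The entropy rate in nats. -/
def natEnt (π : S → ℝ) (W : S → S → ℝ) : ℝ := ∑ x, π x * rowEnt W x

lemma matEnt_eq (π : S → ℝ) (W : S → S → ℝ) : matEnt π W = natEnt π W / Real.log 2 := by
  simp only [matEnt, natEnt, rowEnt, Finset.mul_sum, Finset.sum_div]
  refine Finset.sum_congr rfl fun x _ => Finset.sum_congr rfl fun a _ => ?_
  rw [Real.logb, one_div, Real.log_inv]
  ring

/-- A ratio of entropy rates does not depend on the base of the logarithm. -/
lemma one_div_matEnt_mul_sum {T ι : Type*} [Fintype T] [Fintype ι] (π : S → ℝ) (W : S → S → ℝ)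
    (w : ι → ℝ) (ρ : ι → T → ℝ) (V : T → T → ℝ) :
    1 / matEnt π W * ∑ i, w i * matEnt (ρ i) V = (∑ i, w i * natEnt (ρ i) V) / natEnt π W := by
  have hlog : Real.log 2 ≠ 0 := (Real.log_pos one_lt_two).ne'
  simp only [matEnt_eq, ← mul_div_assoc, ← Finset.sum_div]
  field_simp

variable [MeasurableSpace S]

/-- The Shannon entropy (in nats) of the first `n` symbols. -/
def blockEnt (μ : Measure (ℕ → S)) (n : ℕ) : ℝ := ∑ x : Fin n → S, Real.negMulLog (cylP μ x)

omit [Fintype S] in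
/-- The self-information of the first `m + 1` symbols, corrected by a function of the last one. -/
def pot (μ : Measure (ℕ → S)) (g : S → ℝ) (m : ℕ) (ω : ℕ → S) : ℝ :=
  -Real.log (cylP μ (pre ω (m + 1))) + g (ω m)

omit [Fintype S] in
lemma dependsOn_pot (μ : Measure (ℕ → S)) (g : S → ℝ) (m : ℕ) :
    DependsOn (pot μ g m) (Set.Iio (m + 1)) := by
  intro ω ω' h
  simp only [pot, pre_congr h, h m (Set.mem_Iio.2 m.lt_succ_self)]

omit [MeasurableSpace S] in
lemma exists_abs_le (g : S → ℝ) : ∃ G, 0 ≤ G ∧ ∀ x, |g x| ≤ G :=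
  ⟨∑ x, |g x|, Finset.sum_nonneg fun _ _ => abs_nonneg _, fun x =>
    Finset.single_le_sum (f := fun x => |g x|) (fun _ _ => abs_nonneg _) (Finset.mem_univ x)⟩

variable [DiscreteMeasurableSpace S] {μ : Measure (ℕ → S)} [IsProbabilityMeasure μ]
  {p : S → ℝ} {W : S → S → ℝ}

lemma integral_pot_step (hμ : IsMarkovMeasure μ p W) (hW : IsTransMat W) {g k : S → ℝ}
    (hg : ∀ x, rowEnt W x + ∑ a, W x a * g a = k x + g x) {m : ℕ} {f : (ℕ → S) → ℝ}
    (hf : DependsOn f (Set.Iio (m + 1))) :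
    ∫ ω, f ω * (pot μ g (m + 1) ω - pot μ g m ω) ∂μ = ∫ ω, f ω * k (ω m) ∂μ := by
  let u : S → S → ℝ := fun x a => -Real.log (W x a) + g a - g x
  have h1 : ∫ ω, f ω * (pot μ g (m + 1) ω - pot μ g m ω) ∂μ
      = ∫ ω, f ω * u (ω m) (ω (m + 1)) ∂μ := by
    refine integral_congr_ae ?_
    filter_upwards [ae_cylP_pos μ] with ω hω
    have h2 := hω (m + 2)
    rw [cylP_pre_succ hμ] at h2
    have h3 := hω (m + 1)
    have h4 : W (ω m) (ω (m + 1)) ≠ 0 := fun h => by simp [h] at h2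
    simp only [pot, u, cylP_pre_succ hμ, Real.log_mul h3.ne' h4]
    ring
  rw [h1, integral_markov hμ hf]
  refine integral_congr_ae (Eventually.of_forall fun ω => ?_)
  simp only [u, mul_add, mul_sub, Finset.sum_add_distrib, Finset.sum_sub_distrib,
    ← Finset.sum_mul, hW.2]
  have := hg (ω m)
  rw [rowEnt] at this
  rw [← mul_add, ← mul_sub]
  congr 1
  linarith

omit [Fintype S] [MeasurableSpace S] [DiscreteMeasurableSpace S] in
lemma dependsOn_coord {β : Type*} (k : S → β) (m : ℕ) :
    DependsOn (fun ω : ℕ → S => k (ω m)) (Set.Iio (m + 1)) := fun ω ω' h => by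
  simp only [h m (Set.mem_Iio.2 m.lt_succ_self)]

omit [Fintype S] [MeasurableSpace S] [DiscreteMeasurableSpace S] in
lemma dependsOn_const {β : Type*} (b : β) (m : ℕ) :
    DependsOn (fun _ : ℕ → S => b) (Set.Iio m) := fun _ _ _ => rfl

omit [Fintype S] [DiscreteMeasurableSpace S] in
lemma abs_integral_coord_le {g : S → ℝ} {G : ℝ} (hG : ∀ x, |g x| ≤ G) (m : ℕ) :
    |∫ ω, g (ω m) ∂μ| ≤ G := by
  have := norm_integral_le_of_norm_le_const (μ := μ) (f := fun ω => g (ω m))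
    (Eventually.of_forall fun ω => hG (ω m))
  simpa using this

lemma integral_class (hμ : IsMarkovMeasure μ p W) (hW : IsTransMat W) {r : ℕ} {c : S → Fin r}
    (hblock : ∀ y y', c y ≠ c y' → W y y' = 0) (k : Fin r → ℝ) (m : ℕ) :
    ∫ ω, k (c (ω m)) ∂μ = ∑ ξ, wgt c p ξ * k ξ := by
  induction m with
  | zero =>
    have h := integral_pre μ (m := 1) (fun x => k (c (x 0)))
    refine Eq.trans h ?_
    simp only [hμ 1]
    rw [← (Equiv.funUnique (Fin 1) S).symm.sum_comp]
    simp only [wgt, Finset.sum_mul, markovP]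
    rw [← Finset.sum_fiberwise (s := Finset.univ) (g := c)]
    refine Finset.sum_congr rfl fun ξ _ => Finset.sum_congr rfl fun y hy => ?_
    simp [(Finset.mem_filter.1 hy).2]
  | succ m ih =>
    rw [← ih]
    have h := integral_markov hμ (dependsOn_const (1 : ℝ) (m + 1)) (fun _ a => k (c a))
    simp only [one_mul] at h
    rw [h]
    refine integral_congr_ae (Eventually.of_forall fun ω => ?_)
    have h2 : ∀ a, W (ω m) a * k (c a) = W (ω m) a * k (c (ω m)) := by
      intro a
      by_cases ha : c (ω m) = c a
      · rw [ha]
      · rw [hblock _ _ ha, zero_mul, zero_mul]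
    simp only [h2, ← Finset.sum_mul, hW.2, one_mul]

lemma blockEnt_eq_integral (n : ℕ) :
    blockEnt μ n = ∫ ω, -Real.log (cylP μ (pre ω n)) ∂μ := by
  rw [integral_pre μ (fun x => -Real.log (cylP μ x)), blockEnt]
  refine Finset.sum_congr rfl fun x _ => ?_
  rw [Real.negMulLog]
  ring

/-- The block entropies of a Markov chain grow linearly, up to a bounded error. -/
lemma exists_blockEnt_bound (hμ : IsMarkovMeasure μ p W) (hW : IsTransMat W) {r : ℕ}
    {c : S → Fin r} (hblock : ∀ y y', c y ≠ c y' → W y y' = 0) {g : S → ℝ} {k : Fin r → ℝ}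
    (hg : ∀ x, rowEnt W x + ∑ a, W x a * g a = k (c x) + g x) :
    ∃ C, ∀ n : ℕ, |blockEnt μ (n + 1) - (n + 1 : ℕ) * ∑ ξ, wgt c p ξ * k ξ| ≤ C := by
  obtain ⟨G, -, hG⟩ := exists_abs_le g
  set R := ∑ ξ, wgt c p ξ * k ξ
  have hint : ∀ m, Integrable (pot μ g m) μ := fun m =>
    integrable_of_dependsOn μ (dependsOn_pot μ g m)
  have hpot : ∀ m : ℕ, ∫ ω, pot μ g m ω ∂μ = ∫ ω, pot μ g 0 ω ∂μ + m * R := by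
    intro m
    induction m with
    | zero => simp
    | succ m ih =>
      have h := integral_pot_step hμ hW hg (dependsOn_const (1 : ℝ) (m + 1))
      simp only [one_mul] at h
      rw [integral_sub (hint _) (hint _), integral_class hμ hW hblock] at h
      push_cast
      linarith
  refine ⟨|∫ ω, pot μ g 0 ω ∂μ| + |R| + G, fun n => ?_⟩
  have h1 : blockEnt μ (n + 1) = ∫ ω, pot μ g n ω ∂μ - ∫ ω, g (ω n) ∂μ := by
    rw [blockEnt_eq_integral, ← integral_sub (hint n)
      (integrable_of_dependsOn μ (dependsOn_coord g n))]
    simp [pot]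
  have h2 := abs_integral_coord_le (μ := μ) hG n
  rw [h1, hpot]
  push_cast
  calc _ = |∫ ω, pot μ g 0 ω ∂μ + -R + -∫ ω, g (ω n) ∂μ| := by congr 1; ring
    _ ≤ _ := by
      refine (abs_add_le _ _).trans (add_le_add ((abs_add_le _ _).trans ?_) ?_)
      · rw [abs_neg]
      · rwa [abs_neg]

/-- Exponential bound on the probability of atypically likely prefixes. -/
lemma exists_lower_tail (hμ : IsMarkovMeasure μ p W) (hW : IsTransMat W) {g : S → ℝ} {H : ℝ}
    (hg : ∀ x, rowEnt W x + ∑ a, W x a * g a = H + g x) {lam : ℝ} (hlH : lam < H) :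
    ∃ K θ : ℝ, 0 ≤ K ∧ 0 ≤ θ ∧ θ < 1 ∧ ∀ m : ℕ,
      μ.real {ω | Real.exp (-(lam * m)) < cylP μ (pre ω m)} ≤ K * θ ^ m := by
  obtain ⟨G, hG0, hG⟩ := exists_abs_le g
  let Z : S → S → ℝ := fun x a => Real.log (W x a) - g a + g x
  obtain ⟨B, hB0, hB⟩ := exists_abs_le (fun xa : S × S => Z xa.1 xa.2)
  obtain ⟨lam', hl1, hl2⟩ := exists_between hlH
  obtain ⟨s, hs, hsB, hsH⟩ : ∃ s : ℝ, 0 < s ∧ s * (B + 1) ≤ 1 ∧ s * (B + 1) ^ 2 ≤ H - lam' := by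
    refine ⟨min (1 / (B + 1)) ((H - lam') / (B + 1) ^ 2), ?_, ?_, ?_⟩
    · exact lt_min (by positivity) (div_pos (by linarith) (by positivity))
    · rw [← le_div_iff₀ (by positivity)]
      exact min_le_left _ _
    · rw [← le_div_iff₀ (by positivity)]
      exact min_le_right _ _
  let u : S → S → ℝ := fun x a => W x a ^ s * Real.exp (s * (g x - g a))
  have hu : ∀ x, ∑ a, W x a * u x a ≤ Real.exp (-(s * lam')) := by
    intro x
    have h1 : ∀ a, W x a * u x a ≤ W x a * (1 + s * Z x a + (s * (B + 1)) ^ 2) := by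
      intro a
      rcases (hW.1 x a).eq_or_lt with h | h
      · simp [← h]
      refine mul_le_mul_of_nonneg_left ?_ h.le
      have h2 : u x a = Real.exp (s * Z x a) := by
        simp only [u, Z, Real.rpow_def_of_pos h, ← Real.exp_add]
        congr 1
        ring
      have h3 : |s * Z x a| ≤ s * (B + 1) := by
        rw [abs_mul, abs_of_pos hs]
        exact mul_le_mul_of_nonneg_left ((hB (x, a)).trans (by linarith)) hs.le
      have h4 := Real.abs_exp_sub_one_sub_id_le (h3.trans hsB)
      have h5 : (s * Z x a) ^ 2 ≤ (s * (B + 1)) ^ 2 := by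
        rw [← sq_abs (s * Z x a)]
        exact pow_le_pow_left₀ (abs_nonneg _) h3 2
      rw [h2]
      linarith [(abs_le.1 h4).2]
    have h6 : ∑ a, W x a * Z x a = -H := by
      have := hg x
      simp only [rowEnt, mul_neg, Finset.sum_neg_distrib] at this
      simp only [Z, mul_add, mul_sub, Finset.sum_add_distrib, Finset.sum_sub_distrib,
        ← Finset.sum_mul, hW.2]
      linarith
    calc ∑ a, W x a * u x a ≤ ∑ a, W x a * (1 + s * Z x a + (s * (B + 1)) ^ 2) :=
          Finset.sum_le_sum fun a _ => h1 a
      _ = 1 - s * H + (s * (B + 1)) ^ 2 := by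
          have : ∀ a, W x a * (1 + s * Z x a + (s * (B + 1)) ^ 2)
            = W x a * (1 + (s * (B + 1)) ^ 2) + s * (W x a * Z x a) := fun a => by ring
          simp only [this, Finset.sum_add_distrib, ← Finset.sum_mul, ← Finset.mul_sum, hW.2, h6]
          ring
      _ ≤ -(s * lam') + 1 := by nlinarith
      _ ≤ _ := Real.add_one_le_exp _
  let f : ℕ → (ℕ → S) → ℝ := fun m ω =>
    cylP μ (pre ω (m + 1)) ^ s * Real.exp (-(s * g (ω m)))
  have hfdep : ∀ m, DependsOn (f m) (Set.Iio (m + 1)) := by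
    intro m ω ω' h
    simp only [f, pre_congr h, h m (Set.mem_Iio.2 m.lt_succ_self)]
  have hf0 : ∀ m ω, 0 ≤ f m ω := fun m ω =>
    mul_nonneg (Real.rpow_nonneg (cylP_nonneg μ _) _) (Real.exp_pos _).le
  have hfint : ∀ m, Integrable (f m) μ := fun m => integrable_of_dependsOn μ (hfdep m)
  have hbound : ∀ m : ℕ, ∫ ω, f m ω ∂μ ≤ Real.exp (s * G) * Real.exp (-(s * lam')) ^ m := by
    intro m
    induction m with
    | zero =>
      rw [pow_zero, mul_one]
      have : ∫ ω, f 0 ω ∂μ ≤ ∫ _, Real.exp (s * G) ∂μ := by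
        refine integral_mono (hfint 0) (integrable_const _) fun ω => ?_
        calc f 0 ω ≤ 1 * Real.exp (s * G) := by
              refine mul_le_mul (Real.rpow_le_one (cylP_nonneg μ _) (cylP_le_one μ _) hs.le) ?_
                (Real.exp_pos _).le zero_le_one
              refine Real.exp_le_exp.2 ?_
              nlinarith [(abs_le.1 (hG (ω 0))).1]
          _ = _ := one_mul _
      simpa using this
    | succ m ih =>
      have h1 : ∀ ω, f (m + 1) ω = f m ω * u (ω m) (ω (m + 1)) := by
        intro ω
        simp only [f, u, cylP_pre_succ hμ]
        rw [Real.mul_rpow (cylP_nonneg μ _) (hW.1 _ _)]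
        have : Real.exp (-(s * g (ω (m + 1))))
            = Real.exp (-(s * g (ω m))) * Real.exp (s * (g (ω m) - g (ω (m + 1)))) := by
          rw [← Real.exp_add]
          congr 1
          ring
        rw [this]
        ring
      simp only [h1]
      rw [integral_markov hμ (hfdep m)]
      calc _ ≤ ∫ ω, f m ω * Real.exp (-(s * lam')) ∂μ := by
            refine integral_mono ?_ ((hfint m).mul_const _) fun ω =>
              mul_le_mul_of_nonneg_left (hu _) (hf0 m ω)
            refine integrable_of_dependsOn μ (m := m + 1) fun ω ω' h => ?_
            simp only [hfdep m h, h m (Set.mem_Iio.2 m.lt_succ_self)]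
        _ = (∫ ω, f m ω ∂μ) * Real.exp (-(s * lam')) := integral_mul_const _ _
        _ ≤ _ := by
            rw [pow_succ, ← mul_assoc]
            exact mul_le_mul_of_nonneg_right ih (Real.exp_pos _).le
  have htail : ∀ m : ℕ, μ.real {ω | Real.exp (-(lam * (m + 1 : ℕ))) < cylP μ (pre ω (m + 1))}
      ≤ Real.exp (2 * s * G + s * lam') * Real.exp (-(s * (lam' - lam))) ^ (m + 1) := by
    intro m
    set ε := Real.exp (-(s * (lam * (m + 1 : ℕ)))) * Real.exp (-(s * G)) with hε
    have hεpos : 0 < ε := mul_pos (Real.exp_pos _) (Real.exp_pos _)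
    have h1 := mul_meas_ge_le_integral_of_nonneg (Eventually.of_forall (hf0 m)) (hfint m) ε
    have h2 : μ.real {ω | Real.exp (-(lam * (m + 1 : ℕ))) < cylP μ (pre ω (m + 1))}
        ≤ μ.real {ω | ε ≤ f m ω} := by
      refine measureReal_mono fun ω hω => ?_
      simp only [Set.mem_ofPred_eq] at hω ⊢
      refine mul_le_mul ?_ ?_ (Real.exp_pos _).le (Real.rpow_nonneg (cylP_nonneg μ _) _)
      · have := Real.rpow_le_rpow (Real.exp_pos _).le hω.le hs.le
        rw [← Real.exp_mul] at this
        refine le_trans (le_of_eq ?_) this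
        congr 1
        ring
      · refine Real.exp_le_exp.2 ?_
        nlinarith [(abs_le.1 (hG (ω m))).2]
    have h3 : μ.real {ω | ε ≤ f m ω} ≤ ε⁻¹ * (Real.exp (s * G) * Real.exp (-(s * lam')) ^ m) := by
      rw [inv_mul_eq_div, le_div_iff₀ hεpos, mul_comm]
      exact h1.trans (hbound m)
    refine h2.trans (h3.trans (le_of_eq ?_))
    rw [hε, mul_inv, ← Real.exp_neg, ← Real.exp_neg, ← Real.exp_nat_mul, ← Real.exp_nat_mul,
      ← Real.exp_add, ← Real.exp_add, ← Real.exp_add, ← Real.exp_add]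
    congr 1
    push_cast
    ring
  refine ⟨max 1 (Real.exp (2 * s * G + s * lam')), Real.exp (-(s * (lam' - lam))),
    le_max_of_le_left zero_le_one, (Real.exp_pos _).le, ?_, fun m => ?_⟩
  · rw [Real.exp_lt_one_iff]
    nlinarith
  · cases m with
    | zero =>
      rw [pow_zero, mul_one]
      exact measureReal_le_one.trans (le_max_left _ _)
    | succ m =>
      exact (htail m).trans (mul_le_mul_of_nonneg_right (le_max_right _ _)
        (pow_nonneg (Real.exp_pos _).le _))

end Entropy

end RNG

namespace RNG

section Converse

variable {S B : Type*}

/-- The algorithm `φ` has not stopped after `m` coin symbols. -/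
def Alive (φ : List S → Option B) (m : ℕ) (ω : ℕ → S) : Prop := ∀ i ≤ m, φ (preL ω i) = none

/-- The algorithm `φ` has stopped with output `y` after at most `m` coin symbols. -/
def Output (φ : List S → Option B) (m : ℕ) (y : B) (ω : ℕ → S) : Prop :=
  ∃ i ≤ m, φ (preL ω i) = some y ∧ ∀ j < i, φ (preL ω j) = none

lemma preL_congr {m : ℕ} {ω ω' : ℕ → S} (h : ∀ i < m, ω i = ω' i) : preL ω m = preL ω' m :=
  List.map_congr_left fun i hi => h i (List.mem_range.1 hi)

lemma dependsOn_alive (φ : List S → Option B) (m : ℕ) : DependsOn (Alive φ m) (Set.Iio m) := by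
  intro ω ω' h
  refine propext (forall₂_congr fun i hi => ?_)
  rw [preL_congr fun j hj => h j (lt_of_lt_of_le hj hi)]

lemma dependsOn_output (φ : List S → Option B) (m : ℕ) (y : B) :
    DependsOn (Output φ m y) (Set.Iio m) := by
  intro ω ω' h
  have key : ∀ i ≤ m, preL ω i = preL ω' i := fun i hi =>
    preL_congr fun j hj => h j (lt_of_lt_of_le hj hi)
  refine propext (exists_congr fun i => and_congr_right fun hi => ?_)
  rw [key i hi]
  refine and_congr_right fun _ => forall₂_congr fun j hj => ?_
  rw [key j (hj.le.trans hi)]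

/-- The process `ℓ` stopped when the algorithm `φ` stops. -/
def stoppedSum (φ : List S → Option B) (ℓ : ℕ → (ℕ → S) → ℝ) (m : ℕ) (ω : ℕ → S) : ℝ :=
  ∑ j ∈ Finset.range m, (if Alive φ j ω then 1 else 0) * (ℓ (j + 1) ω - ℓ j ω)

lemma stoppedSum_cases (φ : List S → Option B) {ℓ : ℕ → (ℕ → S) → ℝ} {ω : ℕ → S}
    (h0 : ℓ 0 ω = 0) (m : ℕ) :
    (∃ y, ∃ i ≤ m, φ (preL ω i) = some y ∧ (∀ j < i, φ (preL ω j) = none) ∧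
      stoppedSum φ ℓ m ω = ℓ i ω) ∨ (Alive φ m ω ∧ stoppedSum φ ℓ m ω = ℓ m ω) := by
  have halted : ∀ m, (∀ j < m, φ (preL ω j) = none) → stoppedSum φ ℓ m ω = ℓ m ω →
      (∃ y, ∃ i ≤ m, φ (preL ω i) = some y ∧ (∀ j < i, φ (preL ω j) = none) ∧
        stoppedSum φ ℓ m ω = ℓ i ω) ∨ (Alive φ m ω ∧ stoppedSum φ ℓ m ω = ℓ m ω) := by
    intro m hm hs
    cases hφ : φ (preL ω m) with
    | none =>
      refine Or.inr ⟨fun i hi => ?_, hs⟩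
      rcases hi.eq_or_lt with rfl | hi
      · exact hφ
      · exact hm i hi
    | some y => exact Or.inl ⟨y, m, le_rfl, hφ, hm, hs⟩
  induction m with
  | zero => exact halted 0 (fun j hj => absurd hj j.not_lt_zero) (by simp [stoppedSum, h0])
  | succ m ih =>
    rcases ih with ⟨y, i, hi, hy, hj, hs⟩ | ⟨ha, hs⟩
    · refine Or.inl ⟨y, i, hi.trans m.le_succ, hy, hj, ?_⟩
      have hna : ¬ Alive φ m ω := fun ha => by simp [ha i hi] at hy
      rw [← hs, stoppedSum, Finset.sum_range_succ, if_neg hna, zero_mul, add_zero, stoppedSum]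
    · refine halted (m + 1) (fun j hj => ha j (Nat.lt_succ_iff.1 hj)) ?_
      rw [stoppedSum, Finset.sum_range_succ, if_pos ha, one_mul]
      rw [stoppedSum] at hs
      rw [hs]
      ring

variable [Fintype S] [MeasurableSpace S] [DiscreteMeasurableSpace S]
  {μ : Measure (ℕ → S)} [IsProbabilityMeasure μ] {p : S → ℝ} {W : S → S → ℝ}

omit [Fintype S] [DiscreteMeasurableSpace S] in
lemma tendsto_measureReal_output (φ : List S → Option B) (y : B) :
    Tendsto (fun m => μ.real {ω | Output φ m y ω}) atTop
      (nhds (μ.real {ω | ∃ i : ℕ, φ (preL ω i) = some y ∧ ∀ j < i, φ (preL ω j) = none})) := by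
  have hmono : Monotone fun m => {ω | Output φ m y ω} := by
    rintro m m' hm ω ⟨i, hi, h⟩
    exact ⟨i, hi.trans hm, h⟩
  have hU : ⋃ m, {ω | Output φ m y ω}
      = {ω | ∃ i : ℕ, φ (preL ω i) = some y ∧ ∀ j < i, φ (preL ω j) = none} := by
    ext ω
    simp only [Set.mem_iUnion, Set.mem_ofPred_eq, Output]
    constructor
    · rintro ⟨m, i, hi, h⟩
      exact ⟨i, h⟩
    · rintro ⟨i, h⟩
      exact ⟨i, i, le_rfl, h⟩
  rw [← hU]
  exact (ENNReal.tendsto_toReal (measure_ne_top μ _)).comp (tendsto_measure_iUnion_atTop hmono)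

omit [Fintype S] [DiscreteMeasurableSpace S] in
lemma tendsto_output {PY : B → ℝ} {φ : List S → Option B} (hφ : Valid μ PY φ) (y : B) :
    Tendsto (fun m => μ.real {ω | Output φ m y ω}) atTop (nhds (PY y)) := by
  rw [← hφ y]
  exact tendsto_measureReal_output φ y

omit [Fintype S] [MeasurableSpace S] [DiscreteMeasurableSpace S] in
lemma alive_or_output (φ : List S → Option B) (m : ℕ) (ω : ℕ → S) :
    Alive φ m ω ∨ ∃ y, Output φ m y ω := by
  rcases stoppedSum_cases φ (ℓ := fun _ _ => 0) (ω := ω) rfl m with ⟨y, i, hi, hy, hj, -⟩ | ⟨h, -⟩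
  · exact Or.inr ⟨y, i, hi, hy, hj⟩
  · exact Or.inl h

/-- The corrected self-information of the first `m` symbols. -/
def potFrom (μ : Measure (ℕ → S)) (g : S → ℝ) : ℕ → (ℕ → S) → ℝ
  | 0, _ => 0
  | m + 1, ω => pot μ g m ω

omit [Fintype S] [DiscreteMeasurableSpace S] [IsProbabilityMeasure μ] in
lemma dependsOn_potFrom (g : S → ℝ) (m : ℕ) : DependsOn (potFrom μ g m) (Set.Iio m) := by
  cases m with
  | zero => exact fun _ _ _ => rfl
  | succ m => exact dependsOn_pot μ g m

omit [Fintype S] [DiscreteMeasurableSpace S] in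
lemma le_potFrom {g : S → ℝ} {G : ℝ} (hG0 : 0 ≤ G) (hG : ∀ x, |g x| ≤ G) (m : ℕ) (ω : ℕ → S) :
    -Real.log (cylP μ (pre ω m)) - G ≤ potFrom μ g m ω := by
  cases m with
  | zero => simpa [potFrom, cylP_pre_zero] using hG0
  | succ m =>
    have := (abs_le.1 (hG (ω m))).1
    simp only [potFrom, pot]
    linarith

omit [Fintype S] [MeasurableSpace S] [DiscreteMeasurableSpace S] in
lemma dependsOn_alive_mul {φ : List S → Option B} {m n : ℕ} (hmn : m ≤ n) {f : (ℕ → S) → ℝ}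
    (hf : DependsOn f (Set.Iio n)) :
    DependsOn (fun ω => (if Alive φ m ω then 1 else 0) * f ω) (Set.Iio n) := by
  intro ω ω' h
  have h1 : Alive φ m ω = Alive φ m ω' :=
    dependsOn_alive φ m fun i hi => h i (lt_of_lt_of_le hi hmn)
  simp only [h1, hf h]

lemma integrable_stoppedSum_term (φ : List S → Option B) (g : S → ℝ) (j : ℕ) :
    Integrable (fun ω => (if Alive φ j ω then 1 else 0)
      * (potFrom μ g (j + 1) ω - potFrom μ g j ω)) μ := by
  refine integrable_of_dependsOn μ (m := j + 1) (dependsOn_alive_mul j.le_succ ?_)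
  intro ω ω' h
  beta_reduce
  rw [dependsOn_potFrom g (j + 1) h,
    dependsOn_potFrom g j fun i hi => h i (lt_trans hi (Set.mem_Iio.2 j.lt_succ_self))]

lemma integral_stoppedSum_le (hμ : IsMarkovMeasure μ p W) (hW : IsTransMat W) {g : S → ℝ} {H : ℝ}
    (hH : 0 ≤ H) (hg : ∀ x, rowEnt W x + ∑ a, W x a * g a = H + g x) (φ : List S → Option B)
    (m : ℕ) :
    ∫ ω, stoppedSum φ (potFrom μ g) m ω ∂μ
      ≤ |∫ ω, pot μ g 0 ω ∂μ| + H * ∑ j ∈ Finset.range m, μ.real {ω | Alive φ j ω} := by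
  cases m with
  | zero => simp [stoppedSum]
  | succ m =>
    have h0 : ∫ ω, (if Alive φ 0 ω then 1 else 0) * (potFrom μ g 1 ω - potFrom μ g 0 ω) ∂μ
        ≤ |∫ ω, pot μ g 0 ω ∂μ| := by
      by_cases h : φ [] = none
      · have : ∀ ω : ℕ → S, Alive φ 0 ω := by
          intro ω i hi
          rw [Nat.le_zero.1 hi]
          exact h
        simp only [this, if_true, one_mul, potFrom, sub_zero]
        exact le_abs_self _
      · have : ∀ ω : ℕ → S, ¬ Alive φ 0 ω := fun ω ha => h (ha 0 le_rfl)
        simp [this]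
    have h1 : ∀ j : ℕ, ∫ ω, (if Alive φ (j + 1) ω then 1 else 0)
        * (potFrom μ g (j + 1 + 1) ω - potFrom μ g (j + 1) ω) ∂μ
        = H * μ.real {ω | Alive φ (j + 1) ω} := by
      intro j
      have hd : DependsOn (fun ω => if Alive φ (j + 1) ω then (1 : ℝ) else 0)
          (Set.Iio (j + 1)) := by
        simpa using dependsOn_alive_mul (φ := φ) (m := j + 1) le_rfl
          (dependsOn_const (1 : ℝ) (j + 1))
      refine (integral_pot_step hμ hW (k := fun _ => H) hg hd).trans ?_
      rw [integral_mul_const, mul_comm, ← integral_indicator_one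
        (measurableSet_of_dependsOn (dependsOn_alive φ (j + 1)))]
      congr 2
    have h2 : 0 ≤ H * μ.real {ω | Alive φ 0 ω} := mul_nonneg hH measureReal_nonneg
    simp only [stoppedSum]
    rw [integral_finsetSum _ fun j _ => integrable_stoppedSum_term φ g j,
      Finset.sum_range_succ', Finset.sum_range_succ', Finset.sum_congr rfl fun j _ => h1 j,
      mul_add, Finset.mul_sum]
    linarith

lemma le_integral_stoppedSum [Fintype B] (g : S → ℝ) {G : ℝ} (hG0 : 0 ≤ G) (hG : ∀ x, |g x| ≤ G)
    (φ : List S → Option B) (m : ℕ) :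
    ∑ y, Real.negMulLog (μ.real {ω | Output φ m y ω}) - G
      ≤ ∫ ω, stoppedSum φ (potFrom μ g) m ω ∂μ := by
  set a : B → ℝ := fun y => μ.real {ω | Output φ m y ω} with ha
  have hmeas : ∀ y, MeasurableSet {ω | Output φ m y ω} := fun y =>
    measurableSet_of_dependsOn (dependsOn_output φ m y)
  have hint1 : ∀ y, Integrable
      (fun ω => {ω | Output φ m y ω}.indicator (fun _ => (-Real.log (a y))) ω) μ := fun y =>
    (integrable_const _).indicator (hmeas y)
  have h1 : ∑ y, Real.negMulLog (a y) - G
      = ∫ ω, (∑ y, {ω | Output φ m y ω}.indicator (fun _ => (-Real.log (a y))) ω - G) ∂μ := by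
    rw [integral_sub (integrable_finsetSum _ fun y _ => hint1 y) (integrable_const _),
      integral_finsetSum _ fun y _ => hint1 y]
    simp only [integral_indicator_const _ (hmeas _), integral_const, probReal_univ, one_mul,
      smul_eq_mul, Real.negMulLog]
    congr 1
    exact Finset.sum_congr rfl fun y _ => by ring
  rw [h1]
  refine integral_mono_ae ((integrable_finsetSum _ fun y _ => hint1 y).sub (integrable_const _))
    (integrable_finsetSum _ fun j _ => integrable_stoppedSum_term φ g j) ?_
  filter_upwards [ae_cylP_pos μ] with ω hω
  rcases stoppedSum_cases φ (ℓ := potFrom μ g) (ω := ω) rfl m with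
    ⟨y, i, hi, hy, hj, hs⟩ | ⟨hal, hs⟩
  · rw [hs]
    refine le_trans ?_ (le_potFrom hG0 hG i ω)
    have huniq : ∀ y', Output φ m y' ω → y' = y := by
      rintro y' ⟨i', hi', hy', hj'⟩
      have : i' = i := by
        rcases lt_trichotomy i' i with h | h | h
        · simp [hj i' h] at hy'
        · exact h
        · simp [hj' i h] at hy
      subst this
      rw [hy] at hy'
      exact (Option.some.inj hy').symm
    have hmem : ω ∈ {ω | Output φ m y ω} := ⟨i, hi, hy, hj⟩
    rw [Finset.sum_eq_single y (fun y' _ hne => Set.indicator_of_notMem (s := {ω | Output φ m y' ω})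
      (fun h => hne (huniq y' h)) _) (by simp), Set.indicator_of_mem hmem]
    refine sub_le_sub_right (neg_le_neg (Real.log_le_log (hω i) ?_)) G
    refine measureReal_mono fun ω' hω' => ?_
    have hpre : ∀ j ≤ i, preL ω' j = preL ω j := fun j hj =>
      preL_congr fun k hk => hω' ⟨k, lt_of_lt_of_le hk hj⟩
    refine ⟨i, hi, by rw [hpre i le_rfl, hy], fun j hji => ?_⟩
    rw [hpre j hji.le, hj j hji]
  · rw [hs]
    refine le_trans ?_ (le_potFrom hG0 hG m ω)
    rw [Finset.sum_eq_zero]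
    · have := Real.log_nonpos (cylP_nonneg μ (pre ω m)) (cylP_le_one μ (pre ω m))
      linarith
    · intro y _
      refine Set.indicator_of_notMem ?_ _
      rintro ⟨i, hi, hy, -⟩
      simp [hal i hi] at hy

/-- Entropy lower bound on the mean stopping time of an algorithm with exact output law. -/
lemma exists_converse (hμ : IsMarkovMeasure μ p W) (hW : IsTransMat W) {g : S → ℝ} {H : ℝ}
    (hH : 0 < H) (hg : ∀ x, rowEnt W x + ∑ a, W x a * g a = H + g x) :
    ∃ C : ℝ, ∀ (B : Type*) [Fintype B] (PY : B → ℝ) (φ : List S → Option B), Valid μ PY φ →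
      ENNReal.ofReal ((∑ y, Real.negMulLog (PY y) - C) / H) ≤ ∑' m, μ {ω | Alive φ m ω} := by
  obtain ⟨G, hG0, hG⟩ := exists_abs_le g
  refine ⟨G + |∫ ω, pot μ g 0 ω ∂μ|, fun B _ PY φ hφ => ?_⟩
  have hlim : Tendsto (fun m => ENNReal.ofReal
      ((∑ y, Real.negMulLog (μ.real {ω | Output φ m y ω}) - (G + |∫ ω, pot μ g 0 ω ∂μ|)) / H))
      atTop (nhds (ENNReal.ofReal
      ((∑ y, Real.negMulLog (PY y) - (G + |∫ ω, pot μ g 0 ω ∂μ|)) / H))) := by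
    refine ENNReal.tendsto_ofReal (Tendsto.div_const (Tendsto.sub_const ?_ _) _)
    exact tendsto_finsetSum _ fun y _ =>
      (Real.continuous_negMulLog.tendsto _).comp (tendsto_output hφ y)
  refine le_of_tendsto' hlim fun m => ?_
  have h1 := le_integral_stoppedSum (μ := μ) g hG0 hG φ m
  have h2 := integral_stoppedSum_le hμ hW hH.le hg φ m
  calc _ ≤ ENNReal.ofReal (∑ j ∈ Finset.range m, μ.real {ω | Alive φ j ω}) := by
        refine ENNReal.ofReal_le_ofReal ?_
        rw [div_le_iff₀ hH]
        linarith
    _ = ∑ j ∈ Finset.range m, μ {ω | Alive φ j ω} := by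
        rw [ENNReal.ofReal_sum_of_nonneg fun _ _ => measureReal_nonneg]
        exact Finset.sum_congr rfl fun j _ => ofReal_measureReal
    _ ≤ _ := ENNReal.sum_le_tsum _

end Converse

end RNG

namespace RNG

section Intervals

variable {S : Type*} [Fintype S] [LinearOrder S] [MeasurableSpace S] [DiscreteMeasurableSpace S]
  {μ : Measure (ℕ → S)} [IsProbabilityMeasure μ] {m : ℕ}

omit [Fintype S] [MeasurableSpace S] [DiscreteMeasurableSpace S] in
lemma lexLt_iff {x x' : Fin m → S} : lexLt x x' ↔ toLex x < toLex x' := Iff.rfl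

variable (μ) in
/-- The left endpoint of the interval of `x`. -/
def lexLo (x : Fin m → S) : ℝ := μ.real {ω | lexLt (pre ω m) x}

lemma itv_eq (x : Fin m → S) :
    itv (fun x : Fin m → S => cylP μ x) x = Set.Ico (lexLo μ x) (lexLo μ x + cylP μ x) := by
  rw [itv, lexLo, measureReal_pre μ (fun x' => lexLt x' x)]

lemma lexLo_add (x : Fin m → S) :
    lexLo μ x + cylP μ x = μ.real {ω | lexLt (pre ω m) x ∨ pre ω m = x} := by
  have h1 : {ω : ℕ → S | lexLt (pre ω m) x ∨ pre ω m = x}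
      = {ω | lexLt (pre ω m) x} ∪ {ω | pre ω m = x} := rfl
  have h2 : cylP μ x = μ.real {ω | pre ω m = x} := by
    simp only [cylP, Measure.real, funext_iff, pre]
  rw [h1, measureReal_union, lexLo, h2]
  · rw [Set.disjoint_left]
    intro ω h h'
    have h3 : lexLt (pre ω m) x := h
    have h4 : pre ω m = x := h'
    rw [h4, lexLt_iff] at h3
    exact lt_irrefl _ h3
  · exact measurable_pre m (MeasurableSet.of_discrete (s := {x}))

lemma lexLo_add_le {x x' : Fin m → S} (h : lexLt x x') : lexLo μ x + cylP μ x ≤ lexLo μ x' := by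
  rw [lexLo_add]
  refine measureReal_mono fun ω hω => ?_
  rcases hω with hω | hω
  · exact (lexLt_iff.1 hω).trans h
  · exact (congrArg (fun z => lexLt z x') hω).mpr h

lemma disjoint_itv {x x' : Fin m → S} (h : x ≠ x') :
    Disjoint (itv (fun x : Fin m → S => cylP μ x) x)
      (itv (fun x : Fin m → S => cylP μ x) x') := by
  rw [itv_eq, itv_eq, Set.disjoint_left]
  rintro u ⟨h1, h2⟩ ⟨h3, h4⟩
  rcases lt_or_gt_of_ne (toLex.injective.ne h) with hl | hl
  · linarith [lexLo_add_le (μ := μ) (lexLt_iff.2 hl)]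
  · linarith [lexLo_add_le (μ := μ) (lexLt_iff.2 hl)]

omit [Fintype S] [MeasurableSpace S] [DiscreteMeasurableSpace S] in
lemma lexLt_pre_mono {ω ω' : ℕ → S} {n : ℕ} (hmn : m ≤ n) (h : lexLt (pre ω m) (pre ω' m)) :
    lexLt (pre ω n) (pre ω' n) := by
  obtain ⟨i, hi, hlt⟩ := h
  refine ⟨⟨i, i.2.trans_le hmn⟩, fun j hj => ?_, hlt⟩
  exact hi ⟨j, (Fin.lt_def.1 hj).trans i.2⟩ hj

lemma itv_anti (ω : ℕ → S) {n : ℕ} (hmn : m ≤ n) :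
    itv (fun x : Fin n → S => cylP μ x) (pre ω n)
      ⊆ itv (fun x : Fin m → S => cylP μ x) (pre ω m) := by
  rw [itv_eq, itv_eq]
  refine Set.Ico_subset_Ico ?_ ?_
  · exact measureReal_mono fun ω' h => lexLt_pre_mono hmn h
  · rw [lexLo_add, lexLo_add]
    refine measureReal_mono fun ω' h => ?_
    by_contra hne
    have hne' : ¬ (lexLt (pre ω' m) (pre ω m) ∨ pre ω' m = pre ω m) := hne
    push Not at hne'
    have hgt : lexLt (pre ω m) (pre ω' m) :=
      lt_of_le_of_ne (not_lt.1 hne'.1) (toLex.injective.ne hne'.2.symm)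
    have hgt' := lexLt_iff.1 (lexLt_pre_mono hmn hgt)
    rcases h with h | h
    · exact lt_asymm hgt' h
    · exact hgt'.ne (congrArg toLex h).symm

lemma itv_subset (x : Fin m → S) : itv (fun x : Fin m → S => cylP μ x) x ⊆ Set.Ico 0 1 := by
  rw [itv_eq, lexLo_add]
  exact Set.Ico_subset_Ico measureReal_nonneg measureReal_le_one

lemma volume_itv (x : Fin m → S) :
    volume (itv (fun x : Fin m → S => cylP μ x) x) = ENNReal.ofReal (cylP μ x) := by
  rw [itv_eq, Real.volume_Ico, add_sub_cancel_left]

lemma measurableSet_itv (x : Fin m → S) :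
    MeasurableSet (itv (fun x : Fin m → S => cylP μ x) x) := by
  rw [itv_eq]
  exact measurableSet_Ico

lemma volume_biUnion_itv (A : Finset (Fin m → S)) :
    volume (⋃ x ∈ A, itv (fun x : Fin m → S => cylP μ x) x)
      = ENNReal.ofReal (∑ x ∈ A, cylP μ x) := by
  rw [measure_biUnion_finset (fun x _ x' _ h => disjoint_itv h) fun x _ => measurableSet_itv x,
    ENNReal.ofReal_sum_of_nonneg fun x _ => cylP_nonneg μ x]
  simp only [volume_itv]

variable {T : Type*} [Fintype T] [LinearOrder T] [MeasurableSpace T] [DiscreteMeasurableSpace T]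
  {ν : Measure (ℕ → T)} [IsProbabilityMeasure ν]

lemma volume_diff_itv (n : ℕ) :
    volume (Set.Ico (0 : ℝ) 1 \ ⋃ y ∈ (Finset.univ : Finset (Fin n → T)),
      itv (fun y : Fin n → T => cylP ν y) y) = 0 := by
  rw [measure_sdiff (Set.iUnion₂_subset fun y _ => itv_subset y)
    (Finset.measurableSet_biUnion _ fun y _ => measurableSet_itv y).nullMeasurableSet,
    volume_biUnion_itv, sum_cylP, Real.volume_Ico]
  · simp
  · rw [volume_biUnion_itv]
    exact ENNReal.ofReal_ne_top

/-- Only short coin intervals close to an endpoint of a target interval, or long coin intervals,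
can keep the interval algorithm running. -/
lemma measureReal_not_intStopped_le (n m : ℕ) {ε : ℝ} (hε : 0 ≤ ε) :
    μ.real {ω | ¬ IntStopped μ ν n m ω}
      ≤ μ.real {ω | ε < cylP μ (pre ω m)} + ∑ y : Fin n → T, min (cylP ν y) (2 * ε) := by
  let I : (Fin m → S) → Set ℝ := fun x => itv (fun x : Fin m → S => cylP μ x) x
  let J : (Fin n → T) → Set ℝ := fun y => itv (fun y : Fin n → T => cylP ν y) y
  let A : Finset (Fin m → S) := Finset.univ.filter fun x => (∀ y, ¬ I x ⊆ J y) ∧ cylP μ x ≤ ε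
  have h1 : μ.real {ω | ¬ IntStopped μ ν n m ω}
      ≤ μ.real {ω | ε < cylP μ (pre ω m)} + ∑ x ∈ A, cylP μ x := by
    rw [← measureReal_pre μ (m := m) (fun x => (∀ y, ¬ I x ⊆ J y) ∧ cylP μ x ≤ ε)]
    refine (measureReal_mono fun ω hω => ?_).trans (measureReal_union_le _ _)
    by_cases h : ε < cylP μ (pre ω m)
    · exact Or.inl h
    · exact Or.inr ⟨not_exists.1 hω, not_lt.1 h⟩
  refine h1.trans (add_le_add_right ?_ _)
  let U : Set ℝ := ⋃ x ∈ A, I x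
  have hJU : ∀ y, volume (J y ∩ U) ≤ ENNReal.ofReal (min (cylP ν y) (2 * ε)) := by
    intro y
    rw [ENNReal.ofReal_min]
    refine le_min ?_ ?_
    · rw [← volume_itv (μ := ν) y]
      exact measure_mono Set.inter_subset_left
    · set a := lexLo ν y with ha
      set b := lexLo ν y + cylP ν y with hb
      have hJ : J y = Set.Ico a b := itv_eq y
      have hsub : J y ∩ U ⊆ Set.Ico a (a + ε) ∪ Set.Ico (b - ε) b := by
        rintro u ⟨hu, huU⟩
        rw [hJ] at hu
        obtain ⟨x, hx, hux⟩ := Set.mem_iUnion₂.1 huU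
        obtain ⟨hx1, hx2⟩ := (Finset.mem_filter.1 hx).2
        have hns := hx1 y
        have hI : I x = Set.Ico (lexLo μ x) (lexLo μ x + cylP μ x) := itv_eq x
        rw [hI] at hux hns
        rw [hJ] at hns
        by_contra hcon
        rw [Set.mem_union, Set.mem_Ico, Set.mem_Ico] at hcon
        push Not at hcon
        have h2 : a + ε ≤ u := hcon.1 hu.1
        have h3 : u < b - ε := by
          by_contra h
          exact absurd hu.2 (not_lt.2 (hcon.2 (not_lt.1 h)))
        refine hns (Set.Ico_subset_Ico ?_ ?_)
        · linarith [hux.2]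
        · linarith [hux.1]
      refine (measure_mono hsub).trans ((measure_union_le _ _).trans ?_)
      rw [Real.volume_Ico, Real.volume_Ico, add_sub_cancel_left, sub_sub_cancel, two_mul,
        ENNReal.ofReal_add hε hε]
  have hU : U ⊆ (Set.Ico (0 : ℝ) 1 \ ⋃ y ∈ (Finset.univ : Finset (Fin n → T)), J y)
      ∪ ⋃ y ∈ (Finset.univ : Finset (Fin n → T)), J y ∩ U := by
    intro u hu
    obtain ⟨x, -, hux⟩ := Set.mem_iUnion₂.1 hu
    by_cases h : u ∈ ⋃ y ∈ (Finset.univ : Finset (Fin n → T)), J y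
    · obtain ⟨y, hy, huy⟩ := Set.mem_iUnion₂.1 h
      exact Or.inr (Set.mem_iUnion₂.2 ⟨y, hy, huy, hu⟩)
    · exact Or.inl ⟨itv_subset x hux, h⟩
  have hnn : ∀ y : Fin n → T, 0 ≤ min (cylP ν y) (2 * ε) := fun y =>
    le_min (cylP_nonneg ν y) (by positivity)
  refine (ENNReal.ofReal_le_ofReal_iff (Finset.sum_nonneg fun y _ => hnn y)).1 ?_
  rw [← volume_biUnion_itv A, ENNReal.ofReal_sum_of_nonneg fun y _ => hnn y]
  calc volume U ≤ 0 + volume (⋃ y ∈ (Finset.univ : Finset (Fin n → T)), J y ∩ U) := by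
        refine (measure_mono hU).trans ((measure_union_le _ _).trans (le_of_eq ?_))
        rw [volume_diff_itv]
    _ ≤ _ := by
        rw [zero_add]
        exact (measure_biUnion_finset_le _ _).trans (Finset.sum_le_sum fun y _ => hJU y)

lemma tsum_min_le {P lam : ℝ} (hP0 : 0 ≤ P) (hP1 : P ≤ 1) (hlam : 0 < lam) :
    ∑' m : ℕ, ENNReal.ofReal (min P (2 * Real.exp (-(lam * m))))
      ≤ ENNReal.ofReal (Real.negMulLog P / lam
          + P * (Real.log 2 / lam + 1 + (1 - Real.exp (-lam))⁻¹)) := by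
  rcases hP0.eq_or_lt with rfl | hP
  · have : ∀ m : ℕ, min (0 : ℝ) (2 * Real.exp (-(lam * m))) = 0 := fun m =>
      min_eq_left (by positivity)
    simp [this]
  set N := ⌈Real.log (2 / P) / lam⌉₊
  have hr1 : Real.exp (-lam) < 1 := Real.exp_lt_one_iff.2 (by linarith)
  have hlog : 0 ≤ Real.log (2 / P) := Real.log_nonneg (by rw [le_div_iff₀ hP]; linarith)
  have hN1 : Real.log (2 / P) ≤ lam * N := by
    have := Nat.le_ceil (Real.log (2 / P) / lam)
    rwa [div_le_iff₀ hlam, mul_comm] at this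
  have hN2 : (N : ℝ) ≤ Real.log (2 / P) / lam + 1 := (Nat.ceil_lt_add_one (by positivity)).le
  have htail : ∀ m : ℕ, min P (2 * Real.exp (-(lam * (m + N : ℕ)))) ≤ P * Real.exp (-lam) ^ m := by
    intro m
    refine (min_le_right _ _).trans ?_
    have h1 : 2 * Real.exp (-(lam * N)) ≤ P := by
      rw [Real.exp_neg, ← div_eq_mul_inv, div_le_iff₀ (Real.exp_pos _)]
      have := (Real.log_le_iff_le_exp (by positivity)).1 hN1
      rwa [div_le_iff₀ hP, mul_comm] at this
    have h2 : 2 * Real.exp (-(lam * (m + N : ℕ)))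
        = 2 * Real.exp (-(lam * N)) * Real.exp (-lam) ^ m := by
      rw [← Real.exp_nat_mul, mul_assoc, ← Real.exp_add]
      congr 2
      push_cast
      ring
    rw [h2]
    exact mul_le_mul_of_nonneg_right h1 (by positivity)
  have hgeo : ∑' m : ℕ, ENNReal.ofReal (P * Real.exp (-lam) ^ m)
      = ENNReal.ofReal (P * (1 - Real.exp (-lam))⁻¹) := by
    rw [← ENNReal.ofReal_tsum_of_nonneg (fun m => by positivity)
      ((summable_geometric_of_lt_one (Real.exp_pos _).le hr1).mul_left P), tsum_mul_left,
      tsum_geometric_of_lt_one (Real.exp_pos _).le hr1]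
  have hpos : 0 ≤ (1 - Real.exp (-lam))⁻¹ := inv_nonneg.2 (by linarith)
  rw [← ENNReal.summable.sum_add_tsum_nat_add' (k := N)]
  calc _ ≤ ∑ _m ∈ Finset.range N, ENNReal.ofReal P
        + ∑' m : ℕ, ENNReal.ofReal (P * Real.exp (-lam) ^ m) :=
        add_le_add (Finset.sum_le_sum fun m _ => ENNReal.ofReal_le_ofReal (min_le_left _ _))
          (ENNReal.tsum_le_tsum fun m => ENNReal.ofReal_le_ofReal (htail m))
    _ = ENNReal.ofReal (N * P + P * (1 - Real.exp (-lam))⁻¹) := by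
        rw [hgeo, ENNReal.ofReal_add (by positivity) (by positivity), Finset.sum_const,
          Finset.card_range, nsmul_eq_mul, ENNReal.ofReal_mul (p := (N : ℝ)) (Nat.cast_nonneg N),
          ENNReal.ofReal_natCast]
    _ ≤ _ := by
        refine ENNReal.ofReal_le_ofReal ?_
        have h1 := mul_le_mul_of_nonneg_right hN2 hP0
        rw [Real.log_div two_ne_zero hP.ne'] at h1
        refine (add_le_add_left h1 _).trans (le_of_eq ?_)
        rw [Real.negMulLog]
        ring

variable {p : S → ℝ} {W : S → S → ℝ}

/-- Upper bound on the mean stopping time of the interval algorithm. -/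
lemma exists_intAvgT_le (hμ : IsMarkovMeasure μ p W) (hW : IsTransMat W) {g : S → ℝ} {H : ℝ}
    (hg : ∀ x, rowEnt W x + ∑ a, W x a * g a = H + g x) {lam : ℝ} (hlam : 0 < lam)
    (hlH : lam < H) (ν : Measure (ℕ → T)) [IsProbabilityMeasure ν] :
    ∃ C, ∀ n, intAvgT μ ν n ≤ ENNReal.ofReal (blockEnt ν n / lam + C) := by
  obtain ⟨K, θ, hK, hθ0, hθ1, htail⟩ := exists_lower_tail hμ hW hg hlH
  set D := Real.log 2 / lam + 1 + (1 - Real.exp (-lam))⁻¹ with hD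
  have hD0 : 0 ≤ D := by
    have h1 : Real.exp (-lam) < 1 := Real.exp_lt_one_iff.2 (by linarith)
    have h2 : 0 ≤ (1 - Real.exp (-lam))⁻¹ := inv_nonneg.2 (by linarith)
    have h3 : 0 ≤ Real.log 2 / lam := div_nonneg (Real.log_nonneg one_le_two) hlam.le
    linarith
  have hKθ : 0 ≤ K * (1 - θ)⁻¹ := mul_nonneg hK (inv_nonneg.2 (by linarith))
  refine ⟨K * (1 - θ)⁻¹ + D, fun n => ?_⟩
  have hterm : ∀ m : ℕ, μ {ω | ¬ IntStopped μ ν n m ω} ≤ ENNReal.ofReal (K * θ ^ m)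
      + ∑ y : Fin n → T, ENNReal.ofReal (min (cylP ν y) (2 * Real.exp (-(lam * m)))) := by
    intro m
    have hnn : ∀ y : Fin n → T, 0 ≤ min (cylP ν y) (2 * Real.exp (-(lam * m))) := fun y =>
      le_min (cylP_nonneg ν y) (by positivity)
    rw [← ENNReal.ofReal_sum_of_nonneg fun y _ => hnn y,
      ← ENNReal.ofReal_add (by positivity) (Finset.sum_nonneg fun y _ => hnn y),
      ← ofReal_measureReal]
    exact ENNReal.ofReal_le_ofReal ((measureReal_not_intStopped_le n m (Real.exp_pos _).le).trans
      (add_le_add_left (htail m) _))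
  have hneg : ∀ y : Fin n → T, 0 ≤ Real.negMulLog (cylP ν y) / lam := fun y =>
    div_nonneg (Real.negMulLog_nonneg (cylP_nonneg ν y) (cylP_le_one ν y)) hlam.le
  calc intAvgT μ ν n ≤ ∑' m : ℕ, (ENNReal.ofReal (K * θ ^ m)
        + ∑ y : Fin n → T, ENNReal.ofReal (min (cylP ν y) (2 * Real.exp (-(lam * m))))) :=
        ENNReal.tsum_le_tsum hterm
    _ = ENNReal.ofReal (K * (1 - θ)⁻¹) + ∑ y : Fin n → T,
        ∑' m : ℕ, ENNReal.ofReal (min (cylP ν y) (2 * Real.exp (-(lam * m)))) := by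
        rw [ENNReal.tsum_add, Summable.tsum_finsetSum fun _ _ => ENNReal.summable,
          ← ENNReal.ofReal_tsum_of_nonneg (fun m => by positivity)
          ((summable_geometric_of_lt_one hθ0 hθ1).mul_left K), tsum_mul_left,
          tsum_geometric_of_lt_one hθ0 hθ1]
    _ ≤ ENNReal.ofReal (K * (1 - θ)⁻¹) + ∑ y : Fin n → T,
        ENNReal.ofReal (Real.negMulLog (cylP ν y) / lam + cylP ν y * D) :=
        add_le_add_right (Finset.sum_le_sum fun y _ =>
          tsum_min_le (cylP_nonneg ν y) (cylP_le_one ν y) hlam) _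
    _ = _ := by
        have hy : ∀ y : Fin n → T, 0 ≤ Real.negMulLog (cylP ν y) / lam + cylP ν y * D := fun y =>
          add_nonneg (hneg y) (mul_nonneg (cylP_nonneg ν y) hD0)
        rw [← ENNReal.ofReal_sum_of_nonneg fun y _ => hy y,
          ← ENNReal.ofReal_add hKθ (Finset.sum_nonneg fun y _ => hy y), Finset.sum_add_distrib,
          ← Finset.sum_mul, sum_cylP, ← Finset.sum_div, blockEnt]
        congr 1
        ring

variable (μ ν) in
/-- The interval algorithm, as a function of finite coin strings. -/
def intAlg (n : ℕ) (l : List S) : Option (Fin n → T) :=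
  if h : ∃ y : Fin n → T, ∃ (m : ℕ) (x : Fin m → S), l = List.ofFn x ∧
      itv (fun x : Fin m → S => cylP μ x) x ⊆ itv (fun y : Fin n → T => cylP ν y) y
  then some h.choose else none

omit [Fintype S] [LinearOrder S] [MeasurableSpace S] [DiscreteMeasurableSpace S] in
lemma preL_eq_ofFn (ω : ℕ → S) (m : ℕ) : preL ω m = List.ofFn (pre ω m) := by
  rw [preL, List.ofFn_eq_map, ← List.map_coe_finRange_eq_range, List.map_map]
  rfl

omit [Fintype S] [LinearOrder S] [MeasurableSpace S] [DiscreteMeasurableSpace S] in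
lemma eq_of_preL_eq_ofFn {ω : ℕ → S} {m k : ℕ} {x : Fin k → S} (h : preL ω m = List.ofFn x) :
    ∃ hk : m = k, hk ▸ pre ω m = x := by
  have hk : m = k := by simpa [preL] using congrArg List.length h
  subst hk
  rw [preL_eq_ofFn] at h
  exact ⟨rfl, List.ofFn_injective h⟩

omit [DiscreteMeasurableSpace S] [IsProbabilityMeasure μ] [DiscreteMeasurableSpace T]
  [IsProbabilityMeasure ν] in
lemma intAlg_eq_none_iff {n m : ℕ} {ω : ℕ → S} :
    intAlg μ ν n (preL ω m) = none ↔ ¬ IntStopped μ ν n m ω := by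
  have key : (∃ y : Fin n → T, ∃ (k : ℕ) (x : Fin k → S), preL ω m = List.ofFn x ∧
      itv (fun x : Fin k → S => cylP μ x) x ⊆ itv (fun y : Fin n → T => cylP ν y) y)
      ↔ IntStopped μ ν n m ω := by
    refine exists_congr fun y => ⟨?_, fun h => ⟨m, pre ω m, preL_eq_ofFn ω m, h⟩⟩
    rintro ⟨k, x, hx, h⟩
    obtain ⟨rfl, rfl⟩ := eq_of_preL_eq_ofFn hx
    exact h
  rw [← key, intAlg]
  split_ifs with h <;> simp [h]

omit [DiscreteMeasurableSpace S] [IsProbabilityMeasure μ] [DiscreteMeasurableSpace T]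
  [IsProbabilityMeasure ν] in
lemma itv_subset_of_intAlg {n m : ℕ} {ω : ℕ → S} {y : Fin n → T}
    (hy : intAlg μ ν n (preL ω m) = some y) :
    itv (fun x : Fin m → S => cylP μ x) (pre ω m) ⊆ itv (fun y : Fin n → T => cylP ν y) y := by
  rw [intAlg] at hy
  split_ifs at hy with h
  obtain ⟨k, x, hx, hs⟩ := h.choose_spec
  obtain ⟨rfl, rfl⟩ := eq_of_preL_eq_ofFn hx
  rwa [Option.some.inj hy] at hs

omit [DiscreteMeasurableSpace T] [IsProbabilityMeasure ν] in
lemma alive_intAlg_iff {n m : ℕ} {ω : ℕ → S} :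
    Alive (intAlg μ ν n) m ω ↔ ¬ IntStopped μ ν n m ω := by
  refine ⟨fun h => intAlg_eq_none_iff.1 (h m le_rfl), fun h i hi => intAlg_eq_none_iff.2 ?_⟩
  rintro ⟨y, hy⟩
  exact h ⟨y, (itv_anti ω hi).trans hy⟩

lemma measureReal_output_intAlg_le (n m : ℕ) (y : Fin n → T) :
    μ.real {ω | Output (intAlg μ ν n) m y ω} ≤ cylP ν y := by
  let A : Finset (Fin m → S) := Finset.univ.filter fun x =>
    itv (fun x : Fin m → S => cylP μ x) x ⊆ itv (fun y : Fin n → T => cylP ν y) y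
  have h1 : μ.real {ω | Output (intAlg μ ν n) m y ω} ≤ ∑ x ∈ A, cylP μ x := by
    rw [← measureReal_pre μ (m := m) (fun x =>
      itv (fun x : Fin m → S => cylP μ x) x ⊆ itv (fun y : Fin n → T => cylP ν y) y)]
    refine measureReal_mono fun ω hω => ?_
    obtain ⟨i, hi, hy, -⟩ := hω
    exact (itv_anti ω hi).trans (itv_subset_of_intAlg hy)
  refine h1.trans ((ENNReal.ofReal_le_ofReal_iff (cylP_nonneg ν y)).1 ?_)
  rw [← volume_biUnion_itv, ← volume_itv]
  exact measure_mono (Set.iUnion₂_subset fun x hx => (Finset.mem_filter.1 hx).2)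

/-- The interval algorithm generates the target exactly, as soon as it stops almost surely. -/
lemma valid_intAlg {n : ℕ} (hn : intAvgT μ ν n ≠ ⊤) :
    Valid μ (fun y : Fin n → T => cylP ν y) (intAlg μ ν n) := by
  set φ := intAlg μ ν n
  let b : (Fin n → T) → ℝ := fun y =>
    μ.real {ω | ∃ i : ℕ, φ (preL ω i) = some y ∧ ∀ j < i, φ (preL ω j) = none}
  have hb : ∀ y ∈ Finset.univ, b y ≤ cylP ν y := fun y _ =>
    le_of_tendsto' (tendsto_measureReal_output φ y) fun m => measureReal_output_intAlg_le n m y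
  have halive : Tendsto (fun m => μ.real {ω | Alive φ m ω}) atTop (nhds 0) := by
    have h := ENNReal.tendsto_atTop_zero_of_tsum_ne_top hn
    have h2 := (ENNReal.tendsto_toReal ENNReal.zero_ne_top).comp h
    simpa only [φ, alive_intAlg_iff] using! h2
  have hsum : 1 ≤ ∑ y, b y + 0 := by
    refine ge_of_tendsto' ((tendsto_finsetSum _ fun y _ =>
      tendsto_measureReal_output φ y).add halive) fun m => ?_
    calc (1 : ℝ) = μ.real ((⋃ y, {ω | Output φ m y ω}) ∪ {ω | Alive φ m ω}) := by
          rw [← probReal_univ (μ := μ)]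
          congr 1
          refine (Set.eq_univ_of_forall fun ω => ?_).symm
          rcases alive_or_output φ m ω with h | ⟨y, h⟩
          · exact Or.inr h
          · exact Or.inl (Set.mem_iUnion.2 ⟨y, h⟩)
      _ ≤ _ := (measureReal_union_le _ _).trans
          (add_le_add_left (measureReal_iUnion_fintype_le _) _)
  have heq : ∑ y, b y = ∑ y, cylP ν y :=
    le_antisymm (Finset.sum_le_sum hb) (by rw [sum_cylP]; linarith)
  exact fun y => (Finset.sum_eq_sum_iff_of_le hb).1 heq y (Finset.mem_univ y)

end Intervals

end RNG

namespace RNG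

section Rates

variable {S T : Type*} [Fintype S] [MeasurableSpace S] [DiscreteMeasurableSpace S]
  [Fintype T] [MeasurableSpace T] [DiscreteMeasurableSpace T]
  {μ : Measure (ℕ → S)} [IsProbabilityMeasure μ] {ν : Measure (ℕ → T)} [IsProbabilityMeasure ν]
  {p : S → ℝ} {W : S → S → ℝ} {q : T → ℝ} {V : T → T → ℝ}

/-- The block entropy of a Markov chain grows at the mean entropy rate of its classes. -/
lemma tendsto_blockEnt_div (hν : IsMarkovMeasure ν q V) (hV : IsTransMat V) {r : ℕ}
    {c : T → Fin r} (hblock : ∀ y y', c y ≠ c y' → V y y' = 0) {g : T → ℝ} {k : Fin r → ℝ}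
    (hg : ∀ y, rowEnt V y + ∑ a, V y a * g a = k (c y) + g y) :
    Tendsto (fun n : ℕ => blockEnt ν n / n) atTop (nhds (∑ ξ, wgt c q ξ * k ξ)) := by
  obtain ⟨C, hC⟩ := exists_blockEnt_bound hν hV hblock hg
  rw [← tendsto_add_atTop_iff_nat 1, tendsto_iff_dist_tendsto_zero]
  refine squeeze_zero (fun _ => dist_nonneg) (fun n => ?_)
    ((tendsto_add_atTop_iff_nat 1).2 (tendsto_const_div_atTop_nhds_zero_nat C))
  have hn : (0 : ℝ) < (n + 1 : ℕ) := Nat.cast_pos.2 n.succ_pos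
  rw [Real.dist_eq, le_div_iff₀ hn, ← abs_of_pos hn, ← abs_mul, abs_of_pos hn, sub_mul,
    div_mul_cancel₀ _ hn.ne', mul_comm (∑ ξ, _)]
  exact hC n

/-- Every average rate achieved by the interval algorithm is achieved by valid algorithms. -/
lemma AvgAchievable.of_int [LinearOrder S] [LinearOrder T] (hfin : ∀ n, intAvgT μ ν n ≠ ⊤)
    {L : ℝ≥0∞} (h : IntAvgAchievable μ ν L) : AvgAchievable μ ν L := by
  refine ⟨intAlg μ ν, fun n => valid_intAlg (hfin n), le_of_eq_of_le ?_ h⟩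
  simp only [intAvgT, ← alive_intAlg_iff, Alive]

lemma ofReal_div_natCast (x : ℝ) {n : ℕ} (hn : 0 < n) :
    ENNReal.ofReal x / n = ENNReal.ofReal (x / n) := by
  rw [ENNReal.ofReal_div_of_pos (Nat.cast_pos.2 hn), ENNReal.ofReal_natCast]

omit [DiscreteMeasurableSpace T] [IsProbabilityMeasure ν] in
/-- Converse bound on the average rate of valid algorithms. -/
lemma AvgAchievable.le (hμ : IsMarkovMeasure μ p W) (hW : IsTransMat W) {g : S → ℝ} {H R : ℝ}
    (hH : 0 < H) (hg : ∀ x, rowEnt W x + ∑ a, W x a * g a = H + g x)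
    (hR : Tendsto (fun n : ℕ => blockEnt ν n / n) atTop (nhds R)) {L : ℝ≥0∞}
    (hL : AvgAchievable μ ν L) : ENNReal.ofReal (R / H) ≤ L := by
  obtain ⟨φ, hφ, hlim⟩ := hL
  obtain ⟨C, hC⟩ := exists_converse hμ hW hH hg
  have h1 : Tendsto (fun n : ℕ => ENNReal.ofReal ((blockEnt ν n / n - C / n) / H)) atTop
      (nhds (ENNReal.ofReal (R / H))) := by
    refine ENNReal.tendsto_ofReal (Tendsto.div_const ?_ H)
    simpa using hR.sub (tendsto_const_div_atTop_nhds_zero_nat C)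
  rw [← h1.limsup_eq]
  refine le_trans (limsup_le_limsup ?_) hlim
  filter_upwards [eventually_gt_atTop 0] with n hn
  rw [← sub_div, div_right_comm, ← ofReal_div_natCast _ hn]
  exact ENNReal.div_le_div_right (hC _ _ (φ n) (hφ n)) _

/-- Average rate of the interval algorithm. -/
lemma intAvgAchievable [LinearOrder S] [LinearOrder T] (hμ : IsMarkovMeasure μ p W)
    (hW : IsTransMat W) {g : S → ℝ} {H R : ℝ} (hH : 0 < H)
    (hg : ∀ x, rowEnt W x + ∑ a, W x a * g a = H + g x)
    (hR : Tendsto (fun n : ℕ => blockEnt ν n / n) atTop (nhds R)) :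
    IntAvgAchievable μ ν (ENNReal.ofReal (R / H)) := by
  have hcont : Tendsto (fun lam : ℝ => ENNReal.ofReal (R / lam)) (nhdsWithin H (Set.Iio H))
      (nhds (ENNReal.ofReal (R / H))) :=
    ENNReal.tendsto_ofReal (tendsto_const_nhds.div (tendsto_id.mono_left nhdsWithin_le_nhds) hH.ne')
  refine ge_of_tendsto hcont ?_
  filter_upwards [Ioo_mem_nhdsLT hH] with lam hlam
  obtain ⟨C, hC⟩ := exists_intAvgT_le hμ hW hg hlam.1 hlam.2 ν
  have h1 : Tendsto (fun n : ℕ => ENNReal.ofReal (blockEnt ν n / n / lam + C / n)) atTop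
      (nhds (ENNReal.ofReal (R / lam))) := by
    refine ENNReal.tendsto_ofReal ?_
    simpa using (hR.div_const lam).add (tendsto_const_div_atTop_nhds_zero_nat C)
  rw [← h1.limsup_eq]
  refine limsup_le_limsup ?_
  filter_upwards [eventually_gt_atTop 0] with n hn
  rw [div_right_comm, ← add_div, ← ofReal_div_natCast _ hn]
  exact ENNReal.div_le_div_right (hC n) _

/-- Both infimum average rates equal the ratio of the entropy rates of target and coin. -/
lemma Lint_eq_and_Lstar_eq [LinearOrder S] [LinearOrder T] (hμ : IsMarkovMeasure μ p W)
    (hW : IsTransMat W) {g : S → ℝ} {H R : ℝ} (hH : 0 < H)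
    (hg : ∀ x, rowEnt W x + ∑ a, W x a * g a = H + g x)
    (hR : Tendsto (fun n : ℕ => blockEnt ν n / n) atTop (nhds R)) :
    Lint μ ν = ENNReal.ofReal (R / H) ∧ Lstar μ ν = ENNReal.ofReal (R / H) := by
  have hfin : ∀ n, intAvgT μ ν n ≠ ⊤ := by
    obtain ⟨C, hC⟩ := exists_intAvgT_le hμ hW hg (half_pos hH) (half_lt_self hH) ν
    exact fun n => ne_top_of_le_ne_top ENNReal.ofReal_ne_top (hC n)
  have hint := intAvgAchievable hμ hW hH hg hR
  exact ⟨le_antisymm (sInf_le hint)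
      (le_sInf fun L hL => (AvgAchievable.of_int hfin hL).le hμ hW hH hg hR),
    le_antisymm (sInf_le (.of_int hfin hint)) (le_sInf fun L hL => hL.le hμ hW hH hg hR)⟩

end Rates

end RNG

open RNG
/-- **Markov coin / reducible Markov target, average criterion.** For an irreducible
Markov coin `μ` (transition matrix `W`, `H^W(X) > 0`) and a target `ν` that is a Markov
chain whose transition matrix `V` is a direct sum of irreducible matrices on the classes
`c⁻¹(ξ)` with weights `w(ξ)`, the infimum average achievable rates satisfy
`L⋆_int(X,Y) = L⋆(X,Y) = (1/H^W(X)) · Σ_ξ w(ξ) H^{V_ξ}`. -/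
theorem markov_Lstar
    {𝒳 𝒴 : Type*} [Fintype 𝒳] [LinearOrder 𝒳] [MeasurableSpace 𝒳] [DiscreteMeasurableSpace 𝒳]
    [Fintype 𝒴] [LinearOrder 𝒴] [MeasurableSpace 𝒴] [DiscreteMeasurableSpace 𝒴]
    (W : Matrix 𝒳 𝒳 ℝ) (hW : IsTransMat W) (hWirr : IrreducibleMat W)
    (πX : 𝒳 → ℝ) (hπX : IsStationary πX W) (hpos : 0 < matEnt πX W)
    (p : 𝒳 → ℝ) (hp : IsInitial p)
    (μ : Measure (ℕ → 𝒳)) [IsProbabilityMeasure μ] (hμ : IsMarkovMeasure μ p W)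
    (r : ℕ) (c : 𝒴 → Fin r) (V : Matrix 𝒴 𝒴 ℝ) (hV : IsTransMat V)
    (hblock : ∀ y y' : 𝒴, c y ≠ c y' → V y y' = 0)
    (hVirr : ∀ (ξ : Fin r) (y y' : 𝒴), c y = ξ → c y' = ξ →
      ∃ k : ℕ, 1 ≤ k ∧ 0 < (V ^ k) y y')
    (πY : Fin r → 𝒴 → ℝ) (hπY : ∀ ξ, IsStationary (πY ξ) V)
    (hsupp : ∀ (ξ : Fin r) (y : 𝒴), c y ≠ ξ → πY ξ y = 0)
    (q : 𝒴 → ℝ) (hq : IsInitial q)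
    (ν : Measure (ℕ → 𝒴)) [IsProbabilityMeasure ν] (hν : IsMarkovMeasure ν q V) :
    Lint μ ν
        = ENNReal.ofReal ((1 / matEnt πX W) * ∑ ξ : Fin r, wgt c q ξ * matEnt (πY ξ) V)
    ∧ Lstar μ ν
        = ENNReal.ofReal ((1 / matEnt πX W) * ∑ ξ : Fin r, wgt c q ξ * matEnt (πY ξ) V) := by
  have hH : 0 < natEnt πX W :=
    (div_pos_iff_of_pos_right (Real.log_pos one_lt_two)).1 (matEnt_eq πX W ▸ hpos)
  obtain ⟨gX, hgX⟩ := exists_poisson hW (c := fun _ => (0 : Fin 1)) (fun _ _ h => absurd rfl h)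
    (fun _ x x' _ _ => hWirr x x') (π := fun _ => πX) (fun _ => hπX)
    (fun ξ _ h => absurd (Subsingleton.elim _ ξ) h) (rowEnt W)
  obtain ⟨gY, hgY⟩ := exists_poisson hV hblock hVirr hπY hsupp (rowEnt V)
  have hR := tendsto_blockEnt_div (k := fun ξ => natEnt (πY ξ) V) hν hV hblock hgY
  have hratio : 1 / matEnt πX W * ∑ ξ, wgt c q ξ * matEnt (πY ξ) V
      = (∑ ξ, wgt c q ξ * natEnt (πY ξ) V) / natEnt πX W :=
    one_div_matEnt_mul_sum πX W _ πY V
  rw [hratio]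
  exact Lint_eq_and_Lstar_eq hμ hW hH hgX hR
end
end

section
/- Let X = {X^m} be the independent non-stationary Bernoulli process with P_{X_i}(1) = 2^{−1/i} (harmonic Bernoulli coin). Then: (a) the min-entropy satisfies H_min(X^m) = Σ_{i=1}^m 1/i ≥ ln(m+1), so lim_{m→∞} P_{X^m}(S_m^c(λ)) = 0 for every λ > 0; yet (b) (1/m)H(X^m) ≤ h(2^{−(ln m + 1)/m}), and consequently the spectral inf-entropy satisfies H_(X) = 0. -/
open MeasureTheory Filter
open scoped ENNReal Classical

noncomputable section

open RNG

lemma sum_pi_prod_eq_one (Q : ℕ → Bool → ℝ) (hsum : ∀ i, ∑ b, Q i b = 1) (m : ℕ) :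
    ∑ x : Fin m → Bool, ∏ i : Fin m, Q i (x i) = 1 := by
  have h := Finset.prod_univ_sum (fun _ : Fin m => (Finset.univ : Finset Bool))
    (fun (i : Fin m) b => Q i b)
  rw [Fintype.piFinset_univ] at h
  rw [← h]
  exact Finset.prod_eq_one fun i _ => hsum i

/-- The entropy of a product distribution is the sum of the entropies of its factors. -/
lemma entropy_pi_prod (Q : ℕ → Bool → ℝ) (hpos : ∀ i b, 0 < Q i b)
    (hsum : ∀ i, ∑ b, Q i b = 1) (m : ℕ) :
    ∑ x : Fin m → Bool, (∏ i : Fin m, Q i (x i)) * Real.logb 2 (1 / ∏ i : Fin m, Q i (x i))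
      = ∑ i ∈ Finset.range m, ∑ b, Q i b * Real.logb 2 (1 / Q i b) := by
  induction m with
  | zero => simp
  | succ m ih =>
    rw [Finset.sum_range_succ, ← ih, ← (Fin.snocEquiv (fun _ : Fin (m + 1) => Bool)).sum_comp,
      Fintype.sum_prod_type]
    have hP : ∀ x : Fin m → Bool, 0 < ∏ i : Fin m, Q i (x i) :=
      fun x => Finset.prod_pos fun i _ => hpos _ _
    have hterm : ∀ (b : Bool) (x : Fin m → Bool),
        (∏ i : Fin (m + 1), Q i (Fin.snocEquiv (fun _ : Fin (m + 1) => Bool) (b, x) i)) *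
          Real.logb 2 (1 / ∏ i : Fin (m + 1),
            Q i (Fin.snocEquiv (fun _ : Fin (m + 1) => Bool) (b, x) i))
        = Q m b * ((∏ i : Fin m, Q i (x i)) * Real.logb 2 (1 / ∏ i : Fin m, Q i (x i)))
          + (Q m b * Real.logb 2 (1 / Q m b)) * ∏ i : Fin m, Q i (x i) := by
      intro b x
      have hsplit : (∏ i : Fin (m + 1),
          Q i (Fin.snocEquiv (fun _ : Fin (m + 1) => Bool) (b, x) i))
          = (∏ i : Fin m, Q i (x i)) * Q m b := by
        rw [Fin.prod_univ_castSucc]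
        simp [Fin.snocEquiv]
      rw [hsplit, one_div, one_div, one_div, Real.logb_inv, Real.logb_inv, Real.logb_inv,
        Real.logb_mul (hP x).ne' (hpos m b).ne']
      ring
    simp_rw [hterm, Finset.sum_add_distrib, ← Finset.mul_sum, sum_pi_prod_eq_one Q hsum m,
      mul_one]
    rw [← Finset.sum_mul, hsum m, one_mul]

lemma binEnt_eq_binEntropy_div (t : ℝ) : binEnt t = Real.binEntropy t / Real.log 2 := by
  simp only [binEnt, Real.binEntropy, Real.logb, one_div]
  ring

lemma half_lt_two_rpow_neg {x : ℝ} (hx : x < 1) : 2⁻¹ < (2 : ℝ) ^ (-x) := by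
  rw [← Real.rpow_neg_one]
  exact Real.rpow_lt_rpow_of_exponent_lt one_lt_two (by linarith)

lemma half_le_two_rpow_neg {x : ℝ} (hx : x ≤ 1) : 2⁻¹ ≤ (2 : ℝ) ^ (-x) := by
  rw [← Real.rpow_neg_one]
  exact Real.rpow_le_rpow_of_exponent_le one_le_two (by linarith)

lemma two_rpow_neg_lt_one {x : ℝ} (hx : 0 < x) : (2 : ℝ) ^ (-x) < 1 :=
  Real.rpow_lt_one_of_one_lt_of_neg one_lt_two (by linarith)

/-- `x ↦ h(2^{-x})` is concave on `[0, 1]`. -/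
lemma concaveOn_binEntropy_two_rpow_neg :
    ConcaveOn ℝ (Set.Icc (0 : ℝ) 1) (fun x => Real.binEntropy ((2 : ℝ) ^ (-x))) := by
  have hcont : Continuous (fun x : ℝ => (2 : ℝ) ^ (-x)) :=
    Real.continuous_const_rpow two_ne_zero |>.comp continuous_neg
  have hderiv : ∀ x ∈ Set.Ioo (0 : ℝ) 1,
      HasDerivAt (fun x => Real.binEntropy ((2 : ℝ) ^ (-x)))
        (Real.log 2 * ((2 : ℝ) ^ (-x) *
          (Real.log ((2 : ℝ) ^ (-x)) - Real.log (1 - (2 : ℝ) ^ (-x))))) x := by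
    intro x hx
    have h1 : HasDerivAt (fun x : ℝ => (2 : ℝ) ^ (-x))
        (Real.log 2 * (-1) * (2 : ℝ) ^ (-x)) x :=
      (hasDerivAt_neg x).const_rpow two_pos
    have h2 := Real.hasDerivAt_binEntropy (p := (2 : ℝ) ^ (-x)) (by positivity)
      (two_rpow_neg_lt_one hx.1).ne
    have h3 := h2.comp x h1
    have h4 : HasDerivAt (fun x : ℝ => Real.binEntropy ((2 : ℝ) ^ (-x))) _ x := h3
    exact h4.congr_deriv (by ring)
  have hcont' : Continuous (fun x : ℝ => Real.binEntropy ((2 : ℝ) ^ (-x))) :=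
    Real.binEntropy_continuous.comp hcont
  apply AntitoneOn.concaveOn_of_deriv (convex_Icc 0 1) hcont'.continuousOn
  · rw [interior_Icc]
    exact fun x hx => (hderiv x hx).differentiableAt.differentiableWithinAt
  · rw [interior_Icc]
    intro x hx y hy hxy
    rw [(hderiv x hx).deriv, (hderiv y hy).deriv]
    have hxy' : (2 : ℝ) ^ (-y) ≤ (2 : ℝ) ^ (-x) :=
      Real.rpow_le_rpow_of_exponent_le one_le_two (by linarith)
    have hx1 := two_rpow_neg_lt_one hx.1
    have hy1 := two_rpow_neg_lt_one hy.1
    have hy2 := half_lt_two_rpow_neg hy.2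
    have hy0 : (0 : ℝ) < 2 ^ (-y) := by positivity
    have hl : Real.log (1 - (2 : ℝ) ^ (-y)) ≤ Real.log ((2 : ℝ) ^ (-y)) :=
      Real.log_le_log (by linarith) (by linarith)
    have hl1 := Real.log_le_log hy0 hxy'
    have hl2 : Real.log (1 - (2 : ℝ) ^ (-x)) ≤ Real.log (1 - (2 : ℝ) ^ (-y)) :=
      Real.log_le_log (by linarith) (by linarith)
    have hlog : 0 < Real.log 2 := Real.log_pos one_lt_two
    gcongr

lemma sum_one_div_eq_harmonic (m : ℕ) :
    ∑ i ∈ Finset.range m, 1 / ((i : ℝ) + 1) = (harmonic m : ℝ) := by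
  simp [harmonic]

/-- The average of `h(2^{-1/i})` over `1 ≤ i ≤ m` is at most `h(2^{-(ln m + 1)/m})`. -/
lemma sum_binEntropy_two_rpow_div_le (m : ℕ) (hm : 1 ≤ m) :
    (∑ i ∈ Finset.range m, Real.binEntropy ((2 : ℝ) ^ (-(1 / ((i : ℝ) + 1))))) / m
      ≤ Real.binEntropy ((2 : ℝ) ^ (-((Real.log (m : ℝ) + 1) / (m : ℝ)))) := by
  have hm0 : (0 : ℝ) < m := by exact_mod_cast hm
  have hmem : ∀ i ∈ Finset.range m, 1 / ((i : ℝ) + 1) ∈ Set.Icc (0 : ℝ) 1 := by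
    intro i _
    refine ⟨by positivity, ?_⟩
    rw [div_le_one (by positivity)]
    linarith [(Nat.cast_nonneg i : (0 : ℝ) ≤ i)]
  have hJ := concaveOn_binEntropy_two_rpow_neg.le_map_sum (t := Finset.range m)
    (w := fun _ => (m : ℝ)⁻¹) (p := fun i => 1 / ((i : ℝ) + 1))
    (fun _ _ => by positivity) (by simp [hm0.ne']) hmem
  simp only [smul_eq_mul, ← Finset.mul_sum] at hJ
  rw [sum_one_div_eq_harmonic, inv_mul_eq_div, inv_mul_eq_div] at hJ
  refine hJ.trans ?_
  have hle : (harmonic m : ℝ) / m ≤ (Real.log m + 1) / m := by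
    gcongr
    linarith [harmonic_le_one_add_log m]
  have hle1 : (Real.log m + 1) / m ≤ 1 := by
    rw [div_le_one hm0]
    linarith [Real.log_le_sub_one_of_pos hm0]
  have hH0 : (0 : ℝ) ≤ (harmonic m : ℝ) / m := by
    rw [← sum_one_div_eq_harmonic]
    positivity
  refine Real.binEntropy_strictAntiOn.antitoneOn ⟨half_le_two_rpow_neg hle1, ?_⟩
    ⟨half_le_two_rpow_neg (hle.trans hle1), ?_⟩
    (Real.rpow_le_rpow_of_exponent_le one_le_two (by linarith))
  · exact Real.rpow_le_one_of_one_le_of_nonpos one_le_two (by linarith)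
  · exact Real.rpow_le_one_of_one_le_of_nonpos one_le_two (by linarith)

lemma tendsto_binEntropy_two_rpow_log_div :
    Tendsto (fun m : ℕ => Real.binEntropy ((2 : ℝ) ^ (-((Real.log (m : ℝ) + 1) / (m : ℝ)))))
      atTop (nhds 0) := by
  have h1 : Tendsto (fun m : ℕ => (Real.log (m : ℝ) + 1) / (m : ℝ)) atTop (nhds 0) := by
    have ha : Tendsto (fun m : ℕ => Real.log (m : ℝ) / (m : ℝ)) atTop (nhds 0) :=
      Real.isLittleO_log_id_atTop.tendsto_div_nhds_zero.comp tendsto_natCast_atTop_atTop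
    simpa [add_div] using ha.add (tendsto_one_div_atTop_nhds_zero_nat (𝕜 := ℝ))
  have hc : Continuous (fun x : ℝ => Real.binEntropy ((2 : ℝ) ^ (-x))) :=
    Real.binEntropy_continuous.comp
      (Real.continuous_const_rpow two_ne_zero |>.comp continuous_neg)
  have h := (hc.tendsto 0).comp h1
  rw [neg_zero, Real.rpow_zero, Real.binEntropy_one] at h
  exact h

/-- Every term of the entropy sum is nonnegative. -/
lemma cylP_mul_logb_nonneg (μ : Measure (ℕ → Bool)) [IsProbabilityMeasure μ] {m : ℕ}
    (x : Fin m → Bool) : 0 ≤ cylP μ x * Real.logb 2 (1 / cylP μ x) := by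
  have h0 : 0 ≤ cylP μ x := ENNReal.toReal_nonneg
  have h1 : cylP μ x ≤ 1 :=
    ENNReal.toReal_le_of_le_ofReal zero_le_one (by simpa using prob_le_one)
  rw [one_div, Real.logb_inv]
  exact mul_nonneg h0 (neg_nonneg.2 (Real.logb_nonpos one_lt_two h0 h1))

/-- Markov's inequality for the self-information `log (1 / P_{X^m}(X^m))`. -/
lemma measure_cylP_lt_le (μ : Measure (ℕ → Bool)) [IsProbabilityMeasure μ] (m : ℕ)
    {c : ℝ} (hc : 0 < c) (hpos : ∀ x : Fin m → Bool, 0 < cylP μ x) :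
    (μ {ω | cylP μ (pre ω m) < (2 : ℝ) ^ (-c)}).toReal
      ≤ (∑ x : Fin m → Bool, cylP μ x * Real.logb 2 (1 / cylP μ x)) / c := by
  set A : Finset (Fin m → Bool) :=
    Finset.univ.filter (fun x => cylP μ x < (2 : ℝ) ^ (-c)) with hA
  have hsub : {ω | cylP μ (pre ω m) < (2 : ℝ) ^ (-c)}
      ⊆ ⋃ x ∈ A, {ω : ℕ → Bool | ∀ i : Fin m, ω i = x i} := by
    intro ω hω
    simp only [Set.mem_iUnion]
    exact ⟨pre ω m, by simpa [hA] using hω, fun i => rfl⟩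
  have h1 : (μ {ω | cylP μ (pre ω m) < (2 : ℝ) ^ (-c)}).toReal ≤ ∑ x ∈ A, cylP μ x := by
    have h := (measure_mono hsub).trans (measure_biUnion_finset_le (μ := μ) A _)
    have h' := ENNReal.toReal_mono
      (ENNReal.sum_ne_top.2 fun x _ => measure_ne_top μ _) h
    rwa [ENNReal.toReal_sum fun x _ => measure_ne_top μ _] at h'
  rw [le_div_iff₀ hc]
  calc _ ≤ (∑ x ∈ A, cylP μ x) * c := by gcongr
    _ = ∑ x ∈ A, cylP μ x * c := Finset.sum_mul _ _ _
    _ ≤ ∑ x ∈ A, cylP μ x * Real.logb 2 (1 / cylP μ x) := by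
        refine Finset.sum_le_sum fun x hx => mul_le_mul_of_nonneg_left ?_ (hpos x).le
        have hx' : cylP μ x < (2 : ℝ) ^ (-c) := by simpa [hA] using hx
        have := Real.logb_lt_logb one_lt_two (hpos x) hx'
        rw [Real.logb_rpow two_pos (by norm_num)] at this
        rw [one_div, Real.logb_inv]
        linarith
    _ ≤ _ := Finset.sum_le_sum_of_subset_of_nonneg (Finset.subset_univ _)
        fun x _ _ => cylP_mul_logb_nonneg μ x

/-- If the normalized entropy of a process vanishes, then no `λ > 0` belongs to the set
defining its spectral inf-entropy. -/
lemma not_tendsto_measure_of_entropy_div_tendsto_zero (μ : Measure (ℕ → Bool))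
    [IsProbabilityMeasure μ] (hpos : ∀ (m : ℕ) (x : Fin m → Bool), 0 < cylP μ x)
    (hent : Tendsto (fun m : ℕ =>
      (∑ x : Fin m → Bool, cylP μ x * Real.logb 2 (1 / cylP μ x)) / (m : ℝ)) atTop (nhds 0))
    {lam : ℝ} (hlam : 0 < lam) :
    ¬ Tendsto (fun m : ℕ =>
      (μ {ω | (2 : ℝ) ^ (-((m : ℝ) * lam)) ≤ cylP μ (pre ω m)}).toReal) atTop (nhds 0) := by
  intro h
  have hsum := h.add (hent.div_const lam)
  rw [zero_div, add_zero] at hsum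
  refine absurd (ge_of_tendsto hsum ?_) (not_le.2 one_pos)
  filter_upwards [eventually_ge_atTop 1] with m hm
  have hm0 : (0 : ℝ) < m := by exact_mod_cast hm
  have hM := measure_cylP_lt_le μ m (mul_pos hm0 hlam) (hpos m)
  rw [div_div]
  have hcover : (Set.univ : Set (ℕ → Bool)) ⊆
      {ω | (2 : ℝ) ^ (-((m : ℝ) * lam)) ≤ cylP μ (pre ω m)} ∪
        {ω | cylP μ (pre ω m) < (2 : ℝ) ^ (-((m : ℝ) * lam))} :=
    fun ω _ => le_or_gt ((2 : ℝ) ^ (-((m : ℝ) * lam))) (cylP μ (pre ω m))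
  have h1 := (measure_mono hcover).trans (measure_union_le (μ := μ) _ _)
  rw [measure_univ] at h1
  have h2 := ENNReal.toReal_mono
    (ENNReal.add_ne_top.2 ⟨measure_ne_top μ _, measure_ne_top μ _⟩) h1
  rw [ENNReal.toReal_add (measure_ne_top μ _) (measure_ne_top μ _), ENNReal.toReal_one] at h2
  linarith

/-- **Harmonic Bernoulli coin.** Let `μ` be the law of the independent non-stationary
Bernoulli process with `P(X_i = 1) = 2^{-1/i}` (here `X_i` is the `(i+1)`-st coordinate
`ω i`, and `true` stands for the symbol `1`).  Then:
(a) `H_min(X^m) = Σ_{i=1}^m 1/i ≥ ln(m+1)`, hence `P_{X^m}(𝒮_m^c(λ)) → 0` for every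
`λ > 0`; yet (b) `(1/m) H(X^m) ≤ h(2^{-(ln m + 1)/m})` for `m ≥ 1`, and consequently
`H̲(X) = 0`. -/
theorem harmonic_bernoulli_coin
    (μ : Measure (ℕ → Bool)) [IsProbabilityMeasure μ]
    (hμ : ∀ (m : ℕ) (x : Fin m → Bool),
      cylP μ x = ∏ i : Fin m,
        (if x i then (2 : ℝ) ^ (-(1 / ((i : ℕ) + 1 : ℝ)))
          else 1 - (2 : ℝ) ^ (-(1 / ((i : ℕ) + 1 : ℝ))))) :
    (∀ m : ℕ, (⨅ x : Fin m → Bool, Real.logb 2 (1 / cylP μ x))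
        = ∑ i ∈ Finset.range m, 1 / ((i : ℝ) + 1))
    ∧ (∀ m : ℕ, Real.log ((m : ℝ) + 1) ≤ ∑ i ∈ Finset.range m, 1 / ((i : ℝ) + 1))
    ∧ (∀ lam : ℝ, 0 < lam →
        Tendsto (fun m : ℕ => (μ {ω | (2 : ℝ) ^ (-lam) < cylP μ (pre ω m)}).toReal)
          atTop (nhds 0))
    ∧ (∀ m : ℕ, 1 ≤ m →
        (∑ x : Fin m → Bool, cylP μ x * Real.logb 2 (1 / cylP μ x)) / (m : ℝ)
          ≤ binEnt ((2 : ℝ) ^ (-((Real.log (m : ℝ) + 1) / (m : ℝ)))))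
    ∧ specInf μ = 0 := by
  set Q : ℕ → Bool → ℝ := fun i b =>
    if b then (2 : ℝ) ^ (-(1 / ((i : ℝ) + 1))) else 1 - (2 : ℝ) ^ (-(1 / ((i : ℝ) + 1))) with hQ
  have hcyl : ∀ (m : ℕ) (x : Fin m → Bool), cylP μ x = ∏ i : Fin m, Q i (x i) := hμ
  have hinv0 : ∀ i : ℕ, (0 : ℝ) < 1 / ((i : ℝ) + 1) := fun i => by positivity
  have hinv1 : ∀ i : ℕ, 1 / ((i : ℝ) + 1) ≤ 1 := fun i => by
    rw [div_le_one (by positivity)]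
    linarith [(Nat.cast_nonneg i : (0 : ℝ) ≤ i)]
  have hp1 := fun i : ℕ => two_rpow_neg_lt_one (hinv0 i)
  have hp2 := fun i : ℕ => half_le_two_rpow_neg (hinv1 i)
  have hQpos : ∀ i b, 0 < Q i b := by
    rintro i (_ | _)
    · simpa [hQ] using hp1 i
    · simp only [hQ, if_true]
      positivity
  have hQsum : ∀ i, ∑ b, Q i b = 1 := fun i => by simp [hQ]
  have hQle : ∀ i b, Q i b ≤ (2 : ℝ) ^ (-(1 / ((i : ℝ) + 1))) := by
    rintro i (_ | _)
    · have := hp2 i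
      simp only [hQ, Bool.false_eq_true, if_false]
      linarith
    · simp [hQ]
  have hpos : ∀ (m : ℕ) (x : Fin m → Bool), 0 < cylP μ x := fun m x => by
    rw [hcyl]
    exact Finset.prod_pos fun i _ => hQpos _ _
  have hprod : ∀ m : ℕ, ∏ i : Fin m, (2 : ℝ) ^ (-(1 / ((i : ℕ) + 1 : ℝ)))
      = 2 ^ (-∑ i ∈ Finset.range m, 1 / ((i : ℝ) + 1)) := fun m => by
    rw [Fin.prod_univ_eq_prod_range (fun i : ℕ => (2 : ℝ) ^ (-(1 / ((i : ℝ) + 1)))) m,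
      ← Finset.sum_neg_distrib, Real.rpow_sum_of_pos two_pos]
  have hle : ∀ (m : ℕ) (x : Fin m → Bool),
      cylP μ x ≤ 2 ^ (-∑ i ∈ Finset.range m, 1 / ((i : ℝ) + 1)) := fun m x => by
    rw [hcyl, ← hprod]
    exact Finset.prod_le_prod (fun i _ => (hQpos _ _).le) fun i _ => hQle _ _
  have hmin : ∀ (m : ℕ) (x : Fin m → Bool),
      ∑ i ∈ Finset.range m, 1 / ((i : ℝ) + 1) ≤ Real.logb 2 (1 / cylP μ x) := fun m x => by
    have := Real.logb_le_logb_of_le one_lt_two (hpos m x) (hle m x)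
    rw [Real.logb_rpow two_pos (by norm_num)] at this
    rw [one_div, Real.logb_inv]
    linarith
  have hharm : ∀ m : ℕ, Real.log ((m : ℝ) + 1) ≤ ∑ i ∈ Finset.range m, 1 / ((i : ℝ) + 1) :=
    fun m => by
      rw [sum_one_div_eq_harmonic]
      exact_mod_cast log_add_one_le_harmonic m
  have hdiv : Tendsto (fun m : ℕ => ∑ i ∈ Finset.range m, 1 / ((i : ℝ) + 1)) atTop atTop :=
    Real.tendsto_sum_range_one_div_nat_succ_atTop
  have hent : ∀ m : ℕ, 1 ≤ m →
      (∑ x : Fin m → Bool, cylP μ x * Real.logb 2 (1 / cylP μ x)) / (m : ℝ)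
        ≤ binEnt ((2 : ℝ) ^ (-((Real.log (m : ℝ) + 1) / (m : ℝ)))) := fun m hm => by
    have hQent : ∀ i, ∑ b, Q i b * Real.logb 2 (1 / Q i b)
        = Real.binEntropy ((2 : ℝ) ^ (-(1 / ((i : ℝ) + 1)))) / Real.log 2 := fun i => by
      rw [← binEnt_eq_binEntropy_div]
      simp only [Fintype.sum_bool, hQ, binEnt, if_true, Bool.false_eq_true, if_false]
    simp_rw [hcyl]
    rw [entropy_pi_prod Q hQpos hQsum m]
    simp_rw [hQent]
    rw [← Finset.sum_div, binEnt_eq_binEntropy_div, div_right_comm]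
    exact div_le_div_of_nonneg_right (sum_binEntropy_two_rpow_div_le m hm)
      (Real.log_pos one_lt_two).le
  have hent0 : Tendsto (fun m : ℕ =>
      (∑ x : Fin m → Bool, cylP μ x * Real.logb 2 (1 / cylP μ x)) / (m : ℝ)) atTop (nhds 0) := by
    have hlim := tendsto_binEntropy_two_rpow_log_div.div_const (Real.log 2)
    rw [zero_div] at hlim
    refine tendsto_of_tendsto_of_tendsto_of_le_of_le' tendsto_const_nhds hlim
      (Eventually.of_forall fun m => ?_) ?_
    · exact div_nonneg (Finset.sum_nonneg fun x _ => cylP_mul_logb_nonneg μ x) m.cast_nonneg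
    · filter_upwards [eventually_ge_atTop 1] with m hm
      rw [← binEnt_eq_binEntropy_div]
      exact hent m hm
  refine ⟨fun m => le_antisymm ?_ (le_ciInf (hmin m)), hharm, fun lam _ => ?_, hent, ?_⟩
  · refine (ciInf_le (Set.finite_range _).bddBelow (fun _ => true)).trans_eq ?_
    rw [hμ]
    simp only [if_true]
    rw [hprod, one_div, Real.logb_inv, Real.logb_rpow two_pos (by norm_num), neg_neg]
  · refine tendsto_const_nhds.congr' ?_
    filter_upwards [hdiv.eventually_ge_atTop lam] with m hm
    have hempty : {ω | (2 : ℝ) ^ (-lam) < cylP μ (pre ω m)} = ∅ := by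
      refine Set.eq_empty_of_forall_notMem fun ω hω => ?_
      exact not_lt.2 ((hle m _).trans
        (Real.rpow_le_rpow_of_exponent_le one_le_two (by linarith))) hω
    simp [hempty]
  · refine IsGreatest.csSup_eq ⟨?_, fun lam hlam => ?_⟩
    · refine tendsto_const_nhds.congr' ?_
      filter_upwards [hdiv.eventually_ge_atTop 1] with m hm
      have hempty : {ω | (2 : ℝ) ^ (-((m : ℝ) * 0)) ≤ cylP μ (pre ω m)} = ∅ := by
        refine Set.eq_empty_of_forall_notMem fun ω hω => ?_
        have h1 : (2 : ℝ) ^ (-((m : ℝ) * 0)) ≤ cylP μ (pre ω m) := hω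
        rw [mul_zero, neg_zero, Real.rpow_zero] at h1
        linarith [hle m (pre ω m), two_rpow_neg_lt_one (one_pos.trans_le hm)]
      rw [hempty, measure_empty, ENNReal.toReal_zero]
    · by_contra! hcon
      exact not_tendsto_measure_of_entropy_div_tendsto_zero μ hpos hent0 hcon hlam
end
end

section
/- Let X = {X^m} be the independent Bernoulli process with P_{X_i}(1) = 2^{−1/i²}. Then for any δ > 0, lim_{m→∞} P_{X^m}(S_m^c(π²/6 + δ)) ≥ Π_{i=1}^∞ P_{X_i}(1) = 2^{−π²/6} > 0; hence this coin process violates the diverging-randomness condition and cannot be used for exact random number generation by any algorithm. -/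
open MeasureTheory Filter
open scoped ENNReal Classical

noncomputable section

open RNG

section ReciprocalSquares

lemma hasSum_one_div_succ_sq :
    HasSum (fun i : ℕ => 1 / ((i : ℝ) + 1) ^ 2) (Real.pi ^ 2 / 6) := by
  have h := (hasSum_nat_add_iff' 1).2 hasSum_zeta_two
  simpa using h

lemma prod_two_rpow_neg_one_div_succ_sq (m : ℕ) :
    ∏ i ∈ Finset.range m, (2 : ℝ) ^ (-(1 / ((i : ℝ) + 1) ^ 2)) =
      (2 : ℝ) ^ (-∑ i ∈ Finset.range m, 1 / ((i : ℝ) + 1) ^ 2) := by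
  rw [← Finset.sum_neg_distrib, Real.rpow_sum_of_pos two_pos]

lemma tendsto_prod_two_rpow_neg_one_div_succ_sq :
    Tendsto (fun m : ℕ => ∏ i ∈ Finset.range m, (2 : ℝ) ^ (-(1 / ((i : ℝ) + 1) ^ 2)))
      atTop (nhds ((2 : ℝ) ^ (-(Real.pi ^ 2 / 6)))) := by
  simp_rw [prod_two_rpow_neg_one_div_succ_sq]
  exact tendsto_const_nhds.rpow hasSum_one_div_succ_sq.tendsto_sum_nat.neg
    (Or.inl two_ne_zero)

lemma two_rpow_neg_pi_sq_div_six_le_prod (m : ℕ) :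
    (2 : ℝ) ^ (-(Real.pi ^ 2 / 6)) ≤
      ∏ i ∈ Finset.range m, (2 : ℝ) ^ (-(1 / ((i : ℝ) + 1) ^ 2)) := by
  rw [prod_two_rpow_neg_one_div_succ_sq]
  refine Real.rpow_le_rpow_of_exponent_le one_le_two (neg_le_neg ?_)
  exact sum_le_hasSum _ (fun i _ => by positivity) hasSum_one_div_succ_sq

lemma one_quarter_lt_two_rpow_neg_pi_sq_div_six :
    (1 / 4 : ℝ) < (2 : ℝ) ^ (-(Real.pi ^ 2 / 6)) := by
  have h : (1 / 4 : ℝ) = (2 : ℝ) ^ (-2 : ℝ) := by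
    rw [Real.rpow_neg two_pos.le]
    norm_num
  rw [h]
  refine Real.rpow_lt_rpow_of_exponent_lt one_lt_two ?_
  nlinarith [Real.pi_lt_d2, Real.pi_pos]

end ReciprocalSquares

namespace RNG

lemma preL_eq_ofFn_pre {𝒳 : Type*} (ω : ℕ → 𝒳) (m : ℕ) : preL ω m = List.ofFn (pre ω m) := by
  apply List.ext_getElem <;> simp [preL, pre]

lemma measurableSet_setOf_preL {𝒳 : Type*} [MeasurableSpace 𝒳] [Countable 𝒳]
    [MeasurableSingletonClass 𝒳] (p : List 𝒳 → Prop) (m : ℕ) :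
    MeasurableSet {ω : ℕ → 𝒳 | p (preL ω m)} := by
  simp_rw [preL_eq_ofFn_pre]
  have h : Measurable (fun ω : ℕ → 𝒳 => pre ω m) :=
    measurable_pi_lambda _ fun i => measurable_pi_apply _
  exact h (Set.to_countable {x : Fin m → 𝒳 | p (List.ofFn x)}).measurableSet

lemma measurableSet_stops_with_output {𝒳 B : Type*} [MeasurableSpace 𝒳] [Countable 𝒳]
    [MeasurableSingletonClass 𝒳] (φ : List 𝒳 → Option B) (y : B) :
    MeasurableSet
      {ω : ℕ → 𝒳 | ∃ i : ℕ, φ (preL ω i) = some y ∧ ∀ j < i, φ (preL ω j) = none} := by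
  simp only [Set.ofPred_exists, Set.ofPred_and, Set.ofPred_forall]
  exact .iUnion fun i => (measurableSet_setOf_preL (fun l => φ l = some y) i).inter <|
    .iInter fun j => .iInter fun _ => measurableSet_setOf_preL (fun l => φ l = none) j

/-- The first output of an algorithm is unique. -/
lemma output_unique {𝒳 B : Type*} {φ : List 𝒳 → Option B} {ω : ℕ → 𝒳} {y z : B}
    (hy : ∃ i : ℕ, φ (preL ω i) = some y ∧ ∀ j < i, φ (preL ω j) = none)
    (hz : ∃ i : ℕ, φ (preL ω i) = some z ∧ ∀ j < i, φ (preL ω j) = none) : y = z := by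
  obtain ⟨i, hi, hi'⟩ := hy
  obtain ⟨k, hk, hk'⟩ := hz
  rcases lt_trichotomy i k with h | rfl | h
  · simp [hk' i h] at hi
  · exact Option.some_injective _ (hi.symm.trans hk)
  · simp [hi' k h] at hk

/-- A sequence of positive probability `c` makes every algorithm terminate on it, and hence
forces some output to have probability at least `c`. -/
lemma Valid.exists_le_of_measure_singleton_pos {𝒳 B : Type*} [MeasurableSpace 𝒳] [Countable 𝒳]
    [MeasurableSingletonClass 𝒳] [Fintype B] {μ : Measure (ℕ → 𝒳)} [IsProbabilityMeasure μ]
    {PY : B → ℝ} {φ : List 𝒳 → Option B} (hφ : Valid μ PY φ) (hPY : ∑ y, PY y = 1)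
    {ω : ℕ → 𝒳} (hω : 0 < μ.real {ω}) : ∃ y, μ.real {ω} ≤ PY y := by
  let E : B → Set (ℕ → 𝒳) := fun y =>
    {ω | ∃ i : ℕ, φ (preL ω i) = some y ∧ ∀ j < i, φ (preL ω j) = none}
  have hE : ∀ y, MeasurableSet (E y) := measurableSet_stops_with_output φ
  have hμE : ∀ y, μ.real (E y) = PY y := hφ
  have hdisj : Pairwise (Function.onFun Disjoint E) := fun y z hyz =>
    Set.disjoint_left.2 fun _ h₁ h₂ => hyz (output_unique h₁ h₂)
  have hunion : μ.real (⋃ y, E y) = 1 := by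
    rw [measureReal_iUnion_fintype hdisj hE]
    simpa only [hμE] using hPY
  have hmem : ω ∈ ⋃ y, E y := by
    by_contra hnot
    have hd : Disjoint (⋃ y, E y) {ω} := Set.disjoint_singleton_right.2 hnot
    have h := measureReal_union (μ := μ) hd (measurableSet_singleton ω)
    have h' : μ.real ((⋃ y, E y) ∪ {ω}) ≤ 1 := measureReal_le_one
    linarith
  obtain ⟨y, hy⟩ := Set.mem_iUnion.1 hmem
  exact ⟨y, (measureReal_mono (Set.singleton_subset_iff.2 hy)).trans_eq (hμE y)⟩

/-- The probability of a sequence is bounded below by any lower bound on the probabilities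
of its prefixes. -/
lemma le_measureReal_singleton_of_le_cylP {𝒳 : Type*} [MeasurableSpace 𝒳]
    [MeasurableSingletonClass 𝒳] {μ : Measure (ℕ → 𝒳)} [IsFiniteMeasure μ] {ω : ℕ → 𝒳} {c : ℝ}
    (h : ∀ m, c ≤ cylP μ (pre ω m)) : c ≤ μ.real {ω} := by
  let C : ℕ → Set (ℕ → 𝒳) := fun m => {ω' | ∀ i : Fin m, ω' i = pre ω m i}
  have hC : ∀ m, MeasurableSet (C m) := fun m => by
    simp only [C, Set.ofPred_forall]
    refine .iInter fun i => ?_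
    have hi : Measurable fun ω' : ℕ → 𝒳 => ω' i := measurable_pi_apply _
    exact hi (measurableSet_singleton (pre ω m i))
  have hanti : Antitone C := fun m n hmn ω' hω' i => hω' (i.castLE hmn)
  have hinter : ⋂ m, C m = {ω} := by
    ext ω'
    simp only [C, Set.mem_iInter, Set.mem_ofPred_eq, Set.mem_singleton_iff, pre]
    exact ⟨fun h => funext fun k => h (k + 1) (Fin.last k), fun h _ _ => h ▸ rfl⟩
  have hlim := tendsto_measure_iInter_atTop (μ := μ) (fun m => (hC m).nullMeasurableSet) hanti
    ⟨0, measure_ne_top _ _⟩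
  rw [hinter] at hlim
  exact ge_of_tendsto' ((ENNReal.tendsto_toReal (measure_ne_top _ _)).comp hlim) h

end RNG

/-- **A coin unusable for exact random number generation.** Let `μ` be the law of the
independent Bernoulli process with `P(X_i = 1) = 2^{-1/i²}` (here `X_i` is the `(i+1)`-st
coordinate `ω i`, and `true` stands for the symbol `1`).  Then
`Π_{i=1}^∞ P(X_i = 1) = 2^{-π²/6}`, for any `δ > 0` we have
`lim_m P_{X^m}(𝒮_m^c(π²/6 + δ)) ≥ 2^{-π²/6} > 0`, hence the diverging-randomness
condition fails and there is a target distribution for which no algorithm is valid. -/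
theorem square_summable_bernoulli_coin
    (μ : Measure (ℕ → Bool)) [IsProbabilityMeasure μ]
    (hμ : ∀ (m : ℕ) (x : Fin m → Bool),
      cylP μ x = ∏ i : Fin m,
        (if x i then (2 : ℝ) ^ (-(1 / (((i : ℕ) + 1 : ℝ)) ^ 2))
          else 1 - (2 : ℝ) ^ (-(1 / (((i : ℕ) + 1 : ℝ)) ^ 2)))) :
    Tendsto (fun m : ℕ => ∏ i ∈ Finset.range m, (2 : ℝ) ^ (-(1 / ((i : ℝ) + 1) ^ 2)))
        atTop (nhds ((2 : ℝ) ^ (-(Real.pi ^ 2 / 6))))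
    ∧ (0 : ℝ) < (2 : ℝ) ^ (-(Real.pi ^ 2 / 6))
    ∧ (∀ δ : ℝ, 0 < δ →
        (2 : ℝ) ^ (-(Real.pi ^ 2 / 6)) ≤ liminf (fun m : ℕ =>
          (μ {ω | (2 : ℝ) ^ (-(Real.pi ^ 2 / 6 + δ)) < cylP μ (pre ω m)}).toReal) atTop)
    ∧ ¬ (∀ lam : ℝ, 0 < lam →
        Tendsto (fun m : ℕ => (μ {ω | (2 : ℝ) ^ (-lam) < cylP μ (pre ω m)}).toReal)
          atTop (nhds 0))
    ∧ ∃ (n : ℕ) (PY : (Fin n → Bool) → ℝ), (∀ y, 0 ≤ PY y) ∧ (∑ y, PY y = 1) ∧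
        ∀ φ : List Bool → Option (Fin n → Bool), ¬ Valid μ PY φ := by
  have hcyl : ∀ m (ω : ℕ → Bool), (∀ i : Fin m, ω i = true) →
      (2 : ℝ) ^ (-(Real.pi ^ 2 / 6)) ≤ cylP μ (pre ω m) := by
    intro m ω hω
    rw [hμ]
    simp only [pre, hω, if_true]
    rw [Fin.prod_univ_eq_prod_range (fun i : ℕ => (2 : ℝ) ^ (-(1 / ((i : ℝ) + 1) ^ 2)))]
    exact two_rpow_neg_pi_sq_div_six_le_prod m
  have hbound : ∀ δ : ℝ, 0 < δ → ∀ m : ℕ, (2 : ℝ) ^ (-(Real.pi ^ 2 / 6)) ≤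
      (μ {ω | (2 : ℝ) ^ (-(Real.pi ^ 2 / 6 + δ)) < cylP μ (pre ω m)}).toReal := by
    intro δ hδ m
    refine (hcyl m (fun _ => true) fun _ => rfl).trans ?_
    refine measureReal_mono (μ := μ) fun ω hω => ?_
    refine lt_of_lt_of_le ?_ (hcyl m ω hω)
    exact Real.rpow_lt_rpow_of_exponent_lt one_lt_two (by linarith)
  have hpos : (0 : ℝ) < (2 : ℝ) ^ (-(Real.pi ^ 2 / 6)) := Real.rpow_pos_of_pos two_pos _
  refine ⟨tendsto_prod_two_rpow_neg_one_div_succ_sq, hpos, fun δ hδ => ?_, fun h => ?_,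
    2, fun _ => 1 / 4, fun _ => by norm_num, by norm_num, fun φ hφ => ?_⟩
  · refine le_liminf_of_le ?_ (Eventually.of_forall (hbound δ hδ))
    exact (isBoundedUnder_of ⟨1, fun m => measureReal_le_one⟩).isCoboundedUnder_ge
  · exact hpos.not_ge (ge_of_tendsto' (h (Real.pi ^ 2 / 6 + 1) (by positivity))
      (hbound 1 one_pos))
  · have hatom : (2 : ℝ) ^ (-(Real.pi ^ 2 / 6)) ≤ μ.real {fun _ => true} :=
      le_measureReal_singleton_of_le_cylP fun m => hcyl m _ fun _ => rfl
    obtain ⟨_, hy⟩ := hφ.exists_le_of_measure_singleton_pos (by norm_num) (hpos.trans_le hatom)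
    exact (one_quarter_lt_two_rpow_neg_pi_sq_div_six.trans_le hatom).not_ge hy
end
end
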